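/- arXiv:1802.07978 — 3 statements merged into one kernel-verified Lean document; each statement's English description precedes it below -/
import Mathlib

section
/- For all natural numbers n ≥ 1, the sum ∑_{i=0}^{n} 2^{-2i} · C(2i, i) multiplied by 2^{2n+1} equals (n+1) · C(2n+2, n+1); i.e., 2^{2n+1} · ∑_{i=0}^{n} 4^{n-i} · C(2i,i) / 4^n = (n+1) · C(2n+2, n+1), stated integrally: 2 · ∑_{i=0}^{n} 4^{n-i} · C(2i, i) = (n+1) · C(2n+2, n+1). -/
theorem two_mul_sum_aux (n : ℕ) :
    2 * ∑ i ∈ Finset.range (n + 1), 4 ^ (n - i) * Nat.centralBinom i =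
      (n + 1) * Nat.centralBinom (n + 1) := by
  induction n with
  | zero => decide
  | succ n ih =>
    have h : ∑ i ∈ Finset.range (n + 1), 4 ^ (n + 1 - i) * Nat.centralBinom i =
        4 * ∑ i ∈ Finset.range (n + 1), 4 ^ (n - i) * Nat.centralBinom i := by
      rw [Finset.mul_sum]
      refine Finset.sum_congr rfl fun i hi => ?_
      have hi' : i ≤ n := Nat.lt_succ_iff.mp (Finset.mem_range.mp hi)
      rw [Nat.succ_sub hi', pow_succ]
      ring
    rw [Finset.sum_range_succ, h, Nat.succ_mul_centralBinom_succ (n + 1), Nat.sub_self, pow_zero]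
    linear_combination 4 * ih

/-- The identity `2·∑_{i=0}^{n} 4^{n-i}·C(2i,i) = (n+1)·C(2n+2,n+1)`, i.e.
`2^{2n+1}·∑_{i=0}^{n} 2^{-2i}·C(2i,i) = (n+1)·C(2n+2,n+1)`, used in the proof of the formula
for the maximum size of Cambrian acyclic domains. -/
theorem two_mul_sum_central_binomial (n : ℕ) (hn : 1 ≤ n) :
    2 * ∑ i ∈ Finset.range (n + 1), 4 ^ (n - i) * Nat.choose (2 * i) i =
      (n + 1) * Nat.choose (2 * n + 2) (n + 1) := by
  exact two_mul_sum_aux n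
end

section
/- For a finite irreducible Coxeter system (W,S) of rank n with Coxeter number h, the total number of cut paths of the 2-cover is 2^{n-1}·h. Equivalently, the map Φ sending a cut path κ to its induced Coxeter element c_κ is surjective onto the set of Coxeter elements, and each fiber has exactly h elements. -/
open CoxeterSystem

namespace Cambrian

variable {B : Type*} {W : Type*} [Group W]

/-- A single commutation move on words: swap two adjacent letters whose generators commute. -/
def CommStep (M : CoxeterMatrix B) (l₁ l₂ : List B) : Prop :=
  ∃ (u v : List B) (i j : B), M i j = 2 ∧ l₁ = u ++ i :: j :: v ∧ l₂ = u ++ j :: i :: v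

/-- Two words coincide up to commutations. -/
def CommEquiv (M : CoxeterMatrix B) : List B → List B → Prop :=
  Relation.ReflTransGen (CommStep M)

/-- `u` is a prefix of `v` up to commutations. -/
def IsPrefixUpToComm (M : CoxeterMatrix B) (u v : List B) : Prop :=
  ∃ v', CommEquiv M v v' ∧ u <+: v'

/-- A word representing a Coxeter element: each generator occurs exactly once. -/
def IsCoxWord (cw : List B) : Prop := cw.Nodup ∧ ∀ b : B, b ∈ cw

variable {M : CoxeterMatrix B}

/-- Greedy computation of the lexicographically first reduced subword of `c^∞`
representing a given element (fuelled recursion). -/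
noncomputable def sortAux (cs : CoxeterSystem M W) (cw : List B) :
    ℕ → List B → W → List B
  | 0, _, _ => []
  | n + 1, [], g => sortAux cs cw n cw g
  | n + 1, s :: rest, g =>
      if cs.length (cs.simple s * g) < cs.length g then
        s :: sortAux cs cw n rest (cs.simple s * g)
      else sortAux cs cw n rest g

/-- The `c`-sorting word of `w`: the lexicographically first subword of `c^∞`
that is a reduced word for `w`. -/
noncomputable def sortingWord (cs : CoxeterSystem M W) (cw : List B) (w : W) : List B :=
  sortAux cs cw ((cs.length w + 1) * (cw.length + 1)) cw w

/-- `w` is a `c`-singleton: some reduced expression of `w` is a prefix up to commutations of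
the `c`-sorting word of the longest element `w₀`. -/
def IsCSingleton (cs : CoxeterSystem M W) (cw : List B) (w₀ w : W) : Prop :=
  ∃ u : List B, cs.wordProd u = w ∧ cs.IsReduced u ∧
    IsPrefixUpToComm M u (sortingWord cs cw w₀)

/-- The cardinality `S_c` of the Cambrian acyclic domain: the number of `c`-singletons. -/
noncomputable def numSingletons (cs : CoxeterSystem M W) (cw : List B) (w₀ : W) : ℕ :=
  Nat.card {w : W // IsCSingleton cs cw w₀ w}

/-- The Coxeter graph of `M`. -/
def coxGraph (M : CoxeterMatrix B) : SimpleGraph B :=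
  SimpleGraph.fromRel (fun a b => 3 ≤ M a b)

/-- The letter of the infinite word `c^∞` at position `j`. -/
noncomputable def letterAt [Nonempty B] (cw : List B) (j : ℕ) : B :=
  cw.getD (j % cw.length) (Classical.arbitrary B)

/-- The natural partial order on the letters (positions) of the infinite word `c^∞`. -/
def npoInf [Nonempty B] (M : CoxeterMatrix B) (cw : List B) : ℕ → ℕ → Prop :=
  Relation.TransGen (fun a b => a < b ∧ M (letterAt cw a) (letterAt cw b) ≠ 2)

/-- The Hasse (covering) relation of the natural partial order on letters of `c^∞`. -/
def hasseInf [Nonempty B] (M : CoxeterMatrix B) (cw : List B) (a b : ℕ) : Prop :=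
  npoInf M cw a b ∧ ¬ ∃ c : ℕ, npoInf M cw a c ∧ npoInf M cw c b

/-- The directed edges of the `2`-cover `C²_c`: the images, under the projection
`pr_{c^h} : ℕ → ZMod (n·h)`, of the edges of the Hasse diagram of the natural partial
order on the letters of `c^∞`. -/
def coverEdge [Nonempty B] (M : CoxeterMatrix B) (cw : List B) (N : ℕ)
    (x y : ZMod N) : Prop :=
  ∃ a b : ℕ, hasseInf M cw a b ∧ (a : ZMod N) = x ∧ (b : ZMod N) = y

/-- A cut path of a directed graph `E`: a set of edges meeting every (injectively
traversed) directed cycle exactly once. -/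
def IsCutPath {V : Type*} (E : V → V → Prop) (κ : Set (V × V)) : Prop :=
  (∀ p ∈ κ, E p.1 p.2) ∧
    ∀ (m : ℕ), 0 < m → ∀ f : ZMod m → V, Function.Injective f →
      (∀ i : ZMod m, E (f i) (f (i + 1))) → ∃! i : ZMod m, (f i, f (i + 1)) ∈ κ

/-- The label (generator) of a vertex of the `2`-cover. -/
noncomputable def coverLabel [Nonempty B] (cw : List B) {N : ℕ} (x : ZMod N) : B :=
  letterAt cw x.val

section geo
set_option linter.unusedSectionVars false
variable {B : Type*} {W : Type*} [Group W] [Fintype B]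
open Real Module Polynomial.Chebyshev

/-- Entries of the cosine matrix. -/
noncomputable def kf (M : CoxeterMatrix B) (a b : B) : ℝ := - Real.cos (π / M a b)

lemma kf_self (M : CoxeterMatrix B) (a : B) : kf M a a = 1 := by simp [kf]

lemma kf_symm (M : CoxeterMatrix B) (a b : B) : kf M a b = kf M b a := by simp [kf, M.symmetric]

/-- The coroot functional. -/
noncomputable def corootF (M : CoxeterMatrix B) (a : B) : Dual ℝ (B → ℝ) :=
  ∑ b, (2 * kf M a b) • LinearMap.proj b

lemma corootF_apply (M : CoxeterMatrix B) (a : B) (v : B → ℝ) :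
    corootF M a v = 2 * ∑ b, kf M a b * v b := by
  simp [corootF, Finset.mul_sum, mul_assoc]

lemma corootF_single [DecidableEq B] (M : CoxeterMatrix B) (a b : B) :
    corootF M a (Pi.single b 1) = 2 * kf M a b := by
  rw [corootF_apply]
  simp [Pi.single_apply]

lemma corootF_self [DecidableEq B] (M : CoxeterMatrix B) (a : B) :
    corootF M a (Pi.single a 1) = 2 := by
  simp [corootF_single, kf_self]

lemma S_zero_even (j : ℕ) (hj : 2 ≤ j) :
    (S ℝ ((j : ℤ) - 1)).eval (2 * Real.cos (2 * π / (2 * j : ℕ))) = 0 := by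
  have hj0 : (j : ℝ) ≠ 0 := by positivity
  have h := S_two_mul_real_cos (2 * π / (2 * j : ℕ)) ((j : ℤ) - 1)
  have hs : Real.sin (2 * π / (2 * j : ℕ)) ≠ 0 := by
    apply ne_of_gt
    apply Real.sin_pos_of_pos_of_lt_pi
    · push_cast; positivity
    · push_cast
      rw [mul_div_mul_left _ _ two_ne_zero]
      apply div_lt_self Real.pi_pos
      exact_mod_cast hj
  have : Real.sin (((((j : ℤ) - 1 : ℤ) : ℝ) + 1) * (2 * π / (2 * j : ℕ))) = 0 := by
    push_cast
    rw [show ((j : ℝ) - 1 + 1) * (2 * π / (2 * j)) = π by field_simp; ring]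
    exact Real.sin_pi
  rw [this] at h
  exact (mul_eq_zero.mp h).resolve_right hs

lemma S_zero_odd (j : ℕ) (hj : 1 ≤ j) :
    (S ℝ (j : ℤ)).eval (2 * Real.cos (2 * π / (2 * j + 1 : ℕ))) +
    (S ℝ ((j : ℤ) - 1)).eval (2 * Real.cos (2 * π / (2 * j + 1 : ℕ))) = 0 := by
  set θ := 2 * π / (2 * j + 1 : ℕ) with hθ
  have h := S_two_mul_real_cos θ ((j : ℤ) - 1)
  have h2 := S_two_mul_real_cos θ (j : ℤ)
  have hj' : (1 : ℝ) ≤ j := by exact_mod_cast hj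
  have hs : Real.sin θ ≠ 0 := by
    apply ne_of_gt
    apply Real.sin_pos_of_pos_of_lt_pi
    · rw [hθ]; positivity
    · rw [hθ, div_lt_iff₀ (by positivity)]
      push_cast
      nlinarith [Real.pi_pos]
  have e : (((j : ℤ) : ℝ) + 1) * θ = 2 * π - (((((j : ℤ) - 1 : ℤ) : ℝ) + 1) * θ) := by
    rw [hθ]; push_cast; field_simp; ring
  have e2 : Real.sin ((((j : ℤ) : ℝ) + 1) * θ) = - Real.sin (((((j : ℤ) - 1 : ℤ) : ℝ) + 1) * θ) := by
    rw [e, Real.sin_two_pi_sub]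
  have : ((S ℝ (j : ℤ)).eval (2 * Real.cos θ) + (S ℝ ((j : ℤ) - 1)).eval (2 * Real.cos θ))
      * Real.sin θ = 0 := by
    rw [add_mul, h, h2, e2]; ring
  exact (mul_eq_zero.mp this).resolve_right hs

/-- The simple reflection in the geometric representation. -/
noncomputable def geoRefl [DecidableEq B] (M : CoxeterMatrix B) (a : B) :
    (B → ℝ) ≃ₗ[ℝ] (B → ℝ) := reflection (corootF_self M a)

lemma geoRefl_liftable [DecidableEq B] (M : CoxeterMatrix B) : M.IsLiftable (geoRefl M) := by
  intro a b
  by_cases hab : a = b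
  · subst hab
    rw [M.diagonal, pow_one]
    ext v : 1
    exact involutive_reflection (corootF_self M a) v
  have h1 : M a b ≠ 1 := M.off_diagonal a b hab
  ext z : 1
  have ht : 2 * Real.cos (2 * π / M a b) =
      corootF M a (Pi.single b 1) * corootF M b (Pi.single a 1) - 2 := by
    rw [corootF_single, corootF_single, kf_symm M b a, kf,
      show 2 * π / (M a b : ℝ) = 2 * (π / M a b) by ring, Real.cos_two_mul]
    ring
  have key := reflection_mul_reflection_pow_apply (corootF_self M a) (corootF_self M b) (M a b) z
    (2 * Real.cos (2 * π / M a b)) ht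
  unfold geoRefl
  rw [key]
  simp only [corootF_single, kf_symm M b a]
  rcases Nat.even_or_odd' (M a b) with ⟨j, hj | hj⟩
  · rcases Nat.lt_or_ge j 2 with h | h
    · interval_cases j
      · simp [hj]
      · have hk : kf M a b = 0 := by simp [kf, hj]
        rw [hj, hk]
        norm_num
        ext i
        simp
        ring
    · have h0 := S_zero_even j h
      rw [hj, show (((2 * j : ℕ) : ℤ) - 2) / 2 = (j : ℤ) - 1 by omega,
        show (((2 * j : ℕ) : ℤ) - 1) / 2 = (j : ℤ) - 1 by omega, h0]
      simp
  · have h0 := S_zero_odd j (by omega)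
    rw [hj, show (((2 * j + 1: ℕ) : ℤ) - 2) / 2 = (j : ℤ) - 1 by omega,
        show (((2 * j + 1 : ℕ) : ℤ) - 1) / 2 = (j : ℤ) by omega,
        show (((2 * j + 1 : ℕ) : ℤ) - 3) / 2 = (j : ℤ) - 1 by omega,
        show (((2 * j + 1 : ℕ) : ℤ) ) / 2 = (j : ℤ) by omega, h0]
    simp

lemma kf_ne_of_adj (M : CoxeterMatrix B) {a b : B} (h : 3 ≤ M a b) : kf M a b ≤ - (1/2) := by
  unfold kf
  rw [neg_le_neg_iff, ← Real.cos_pi_div_three]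
  apply Real.cos_le_cos_of_nonneg_of_le_pi
  · positivity
  · linarith [Real.pi_pos]
  · apply div_le_div_of_nonneg_left Real.pi_pos.le (by norm_num)
    exact_mod_cast h

lemma kf_nonpos (M : CoxeterMatrix B) {a b : B} (h : a ≠ b) : kf M a b ≤ 0 := by
  have h1 : M a b ≠ 1 := M.off_diagonal a b h
  unfold kf
  rw [neg_nonpos]
  rcases Nat.eq_zero_or_pos (M a b) with h0 | h0
  · simp [h0]
  apply Real.cos_nonneg_of_neg_pi_div_two_le_of_le
  · have : 0 ≤ π / (M a b : ℝ) := by positivity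
    linarith [Real.pi_pos]
  · apply div_le_div_of_nonneg_left Real.pi_pos.le (by norm_num)
    exact_mod_cast (show 2 ≤ M a b by omega)

/-- Existence of an invariant inner product. -/
lemma exists_invariant [Finite W] [DecidableEq B] (M : CoxeterMatrix B) (cs : CoxeterSystem M W) :
    ∃ F : LinearMap.BilinForm ℝ (B → ℝ), (∀ u v, F u v = F v u) ∧ (∀ v, v ≠ 0 → 0 < F v v) ∧
      ∀ a u v, F (geoRefl M a u) (geoRefl M a v) = F u v := by
  have := Fintype.ofFinite W
  let ρ : W →* ((B → ℝ) ≃ₗ[ℝ] (B → ℝ)) := cs.lift ⟨geoRefl M, geoRefl_liftable M⟩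
  have hρ : ∀ a, ρ (cs.simple a) = geoRefl M a := fun a =>
    cs.lift_apply_simple (geoRefl_liftable M) a
  let F : LinearMap.BilinForm ℝ (B → ℝ) := LinearMap.mk₂ ℝ
    (fun u v => ∑ g : W, ∑ i, (ρ g u i) * (ρ g v i))
    (by intros; simp [add_mul, Finset.sum_add_distrib])
    (by intros; simp [mul_assoc, Finset.mul_sum])
    (by intros; simp [mul_add, Finset.sum_add_distrib])
    (by intros; simp [Finset.mul_sum, mul_left_comm])
  have hF : ∀ u v, F u v = ∑ g : W, ∑ i, (ρ g u i) * (ρ g v i) := fun u v => rfl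
  refine ⟨F, ?_, ?_, ?_⟩
  · intro u v; simp [hF, mul_comm]
  · intro v hv
    rw [hF]
    apply Finset.sum_pos'
    · intro g _; exact Finset.sum_nonneg fun i _ => mul_self_nonneg _
    · refine ⟨1, Finset.mem_univ _, ?_⟩
      obtain ⟨i, hi⟩ := Function.ne_iff.mp hv
      apply Finset.sum_pos'
      · intro i _; exact mul_self_nonneg _
      · exact ⟨i, Finset.mem_univ _, by simpa using mul_self_pos.mpr hi⟩
  · intro a u v
    rw [hF, hF]
    rw [← Equiv.sum_comp (Equiv.mulRight (cs.simple a))]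
    have hinv : ∀ z, geoRefl M a (geoRefl M a z) = z :=
      involutive_reflection (corootF_self M a)
    simp only [Equiv.coe_mulRight, map_mul, hρ, LinearEquiv.mul_apply, hinv]

lemma coxGraph_adj (M : CoxeterMatrix B) (a b : B) : (coxGraph M).Adj a b ↔ 3 ≤ M a b := by
  unfold coxGraph
  rw [SimpleGraph.fromRel_adj, M.symmetric b a, or_self]
  constructor
  · exact fun h => h.2
  · intro h
    refine ⟨?_, h⟩
    rintro rfl
    rw [M.diagonal] at h
    omega

lemma exists_posdef [Finite W] [DecidableEq B] (M : CoxeterMatrix B) (cs : CoxeterSystem M W)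
    (hirr : (coxGraph M).Connected) :
    ∃ F : LinearMap.BilinForm ℝ (B → ℝ), (∀ a b, F (Pi.single a 1) (Pi.single b 1) = kf M a b) ∧
      (∀ v, v ≠ 0 → 0 < F v v) := by
  obtain ⟨F, hs, hp, hi⟩ := exists_invariant M cs
  have hsing : ∀ a : B, (Pi.single a 1 : B → ℝ) ≠ 0 := fun a => by simp
  have h1 : ∀ a b, F (Pi.single b 1) (Pi.single a 1) =
      kf M a b * F (Pi.single a 1) (Pi.single a 1) := by
    intro a b
    have h := hi a (Pi.single b 1) (Pi.single a 1)
    have e1 : geoRefl M a (Pi.single a 1) = - Pi.single a 1 :=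
      reflection_apply_self (corootF_self M a)
    have e2 : geoRefl M a (Pi.single b 1) = Pi.single b 1 - (2 * kf M a b) • Pi.single a 1 := by
      rw [geoRefl, reflection_apply, corootF_single]
    rw [e1, e2] at h
    simp only [map_sub, map_smul, LinearMap.sub_apply, LinearMap.smul_apply, map_neg,
      smul_eq_mul] at h
    linarith
  have h2 : ∀ a b, (coxGraph M).Adj a b →
      F (Pi.single a 1) (Pi.single a 1) = F (Pi.single b 1) (Pi.single b 1) := by
    intro a b hab
    rw [coxGraph_adj] at hab
    have := kf_ne_of_adj M hab
    have e := hs (Pi.single a 1) (Pi.single b 1)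
    rw [h1 b a, h1 a b, kf_symm M b a] at e
    exact (mul_left_cancel₀ (by linarith) e).symm
  have h3 : ∀ a b, F (Pi.single a 1) (Pi.single a 1) = F (Pi.single b 1) (Pi.single b 1) := by
    intro a b
    obtain ⟨p⟩ := hirr.preconnected a b
    induction p with
    | nil => rfl
    | cons h p ih => exact (h2 _ _ h).trans ih
  obtain ⟨r⟩ := hirr.nonempty
  have hr := hp _ (hsing r)
  refine ⟨(F (Pi.single r 1) (Pi.single r 1))⁻¹ • F, ?_, ?_⟩
  · intro a b
    rw [LinearMap.smul_apply, LinearMap.smul_apply, h1 b a, h3 b r, kf_symm M b a, smul_eq_mul]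
    field_simp
  · intro v hv
    rw [LinearMap.smul_apply, LinearMap.smul_apply, smul_eq_mul]
    exact mul_pos (inv_pos.mpr hr) (hp v hv)

lemma M_ne_zero [Finite W] (M : CoxeterMatrix B) (cs : CoxeterSystem M W)
    (hirr : (coxGraph M).Connected) (a b : B) : M a b ≠ 0 := by
  classical
  intro h0
  obtain ⟨F, hF, hp⟩ := exists_posdef M cs hirr
  have hab : a ≠ b := by
    rintro rfl
    rw [M.diagonal] at h0
    omega
  have hk : kf M a b = -1 := by simp [kf, h0]
  have := hp (Pi.single a 1 + Pi.single b 1) (by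
    intro h
    have := congrFun h a
    simp [Pi.single_apply, hab] at this)
  simp only [map_add, LinearMap.add_apply, hF, kf_self, kf_symm M b a, hk] at this
  linarith

lemma M_ne_two [Finite W] (M : CoxeterMatrix B) (cs : CoxeterSystem M W)
    (hirr : (coxGraph M).Connected) (a b : B) :
    M a b ≠ 2 ↔ a = b ∨ (coxGraph M).Adj a b := by
  rw [coxGraph_adj]
  have h0 := M_ne_zero M cs hirr a b
  by_cases hab : a = b
  · subst hab
    simp [M.diagonal]
  · have h1 : M a b ≠ 1 := M.off_diagonal a b hab
    simp only [hab, false_or]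
    omega

lemma cox_isTree [Finite W] (M : CoxeterMatrix B) (cs : CoxeterSystem M W)
    (hirr : (coxGraph M).Connected) : (coxGraph M).IsTree := by
  classical
  rw [SimpleGraph.isTree_iff_connected_and_card]
  refine ⟨hirr, le_antisymm ?_ hirr.card_vert_le_card_edgeSet_add_one⟩
  obtain ⟨F, hF, hp⟩ := exists_posdef M cs hirr
  obtain ⟨r⟩ := hirr.nonempty
  have h := hp (∑ a, Pi.single a 1) (by
    intro h
    have := congrFun h r
    simp [Finset.sum_apply, Pi.single_apply] at this)
  simp only [map_sum, LinearMap.sum_apply, hF] at h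
  have hle : ∀ a b, kf M a b ≤ (if a = b then 1 else 0) -
      (1/2) * (if (coxGraph M).Adj a b then 1 else 0) := by
    intro a b
    by_cases hab : a = b
    · subst hab; simp [kf_self]
    · by_cases hh : (coxGraph M).Adj a b
      · have := kf_ne_of_adj M ((coxGraph_adj M a b).mp hh)
        simp only [hab, hh, if_true, if_false]; linarith
      · have := kf_nonpos M hab
        simp only [hab, hh, if_false]; linarith
  have h2 : (0 : ℝ) < ∑ a, ∑ b, ((if a = b then 1 else 0) -
      (1/2) * (if (coxGraph M).Adj a b then 1 else 0)) := by
    refine lt_of_lt_of_le h ?_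
    rw [Finset.sum_comm]
    exact Finset.sum_le_sum fun a _ => Finset.sum_le_sum fun b _ => hle a b
  have h3 := (coxGraph M).sum_degrees_eq_twice_card_edges
  have h4 : ∀ a, ∑ b, (if (coxGraph M).Adj a b then (1 : ℝ) else 0) = (coxGraph M).degree a := by
    intro a
    rw [Finset.sum_boole, ← SimpleGraph.card_neighborFinset_eq_degree]
    congr 2
    ext b; simp
  simp only [Finset.sum_sub_distrib, ← Finset.mul_sum, h4, Finset.sum_ite_eq, Finset.mem_univ,
    if_true, Finset.sum_const, Finset.card_univ, nsmul_eq_mul, mul_one] at h2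
  have h5 : ∑ a, ((coxGraph M).degree a : ℝ) = 2 * ((coxGraph M).edgeFinset.card : ℝ) := by
    exact_mod_cast h3
  rw [h5] at h2
  have h6 : ((coxGraph M).edgeFinset.card : ℝ) < Fintype.card B := by linarith
  have h7 : (coxGraph M).edgeFinset.card < Fintype.card B := by exact_mod_cast h6
  rw [Nat.card_eq_fintype_card, Nat.card_eq_fintype_card, ← SimpleGraph.edgeFinset_card]
  omega

lemma cox_no_spider [Finite W] (M : CoxeterMatrix B) (cs : CoxeterSystem M W)
    (hirr : (coxGraph M).Connected) (z a a' b b' c c' : B)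
    (hnd : [z, a, a', b, b', c, c'].Nodup)
    (h1 : (coxGraph M).Adj z a) (h2 : (coxGraph M).Adj a a')
    (h3 : (coxGraph M).Adj z b) (h4 : (coxGraph M).Adj b b')
    (h5 : (coxGraph M).Adj z c) (h6 : (coxGraph M).Adj c c') : False := by
  classical
  obtain ⟨F, hF, hp⟩ := exists_posdef M cs hirr
  simp only [List.nodup_cons, List.mem_cons, List.not_mem_nil, not_or, or_false,
    List.nodup_nil, not_false_eq_true, and_true] at hnd
  obtain ⟨⟨n1, n2, n3, n4, n5, n6⟩, ⟨n7, n8, n9, n10, n11⟩, ⟨n12, n13, n14, n15⟩,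
    ⟨n16, n17, n18⟩, ⟨n19, n20⟩, n21⟩ := hnd
  have h := hp ((3 : ℝ) • Pi.single z 1 + (2 : ℝ) • Pi.single a 1 + (1 : ℝ) • Pi.single a' 1
    + (2 : ℝ) • Pi.single b 1 + (1 : ℝ) • Pi.single b' 1
    + (2 : ℝ) • Pi.single c 1 + (1 : ℝ) • Pi.single c' 1) (by
    intro h
    have := congrFun h z
    simp [Pi.single_apply, n1, n2, n3, n4, n5, n6] at this)
  simp only [map_add, map_smul, LinearMap.add_apply, LinearMap.smul_apply, smul_eq_mul, hF,
    kf_self] at h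
  rw [coxGraph_adj] at h1 h2 h3 h4 h5 h6
  have g1 := kf_ne_of_adj M h1
  have g2 := kf_ne_of_adj M h2
  have g3 := kf_ne_of_adj M h3
  have g4 := kf_ne_of_adj M h4
  have g5 := kf_ne_of_adj M h5
  have g6 := kf_ne_of_adj M h6
  rw [kf_symm M a z, kf_symm M a' z, kf_symm M b z, kf_symm M b' z, kf_symm M c z, kf_symm M c' z,
    kf_symm M a' a, kf_symm M b a, kf_symm M b' a, kf_symm M c a, kf_symm M c' a,
    kf_symm M b a', kf_symm M b' a', kf_symm M c a', kf_symm M c' a',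
    kf_symm M b' b, kf_symm M c b, kf_symm M c' b,
    kf_symm M c b', kf_symm M c' b', kf_symm M c' c] at h
  linarith [kf_nonpos M n2, kf_nonpos M n4, kf_nonpos M n6, kf_nonpos M n8, kf_nonpos M n9,
    kf_nonpos M n10, kf_nonpos M n11, kf_nonpos M n12, kf_nonpos M n13, kf_nonpos M n14,
    kf_nonpos M n15, kf_nonpos M n17, kf_nonpos M n18, kf_nonpos M n19, kf_nonpos M n20]

end geo

section comb
variable {B : Type*}

/-- On a tree every antisymmetric edge function is a potential difference. -/
lemma tree_potential {G : SimpleGraph B} (hG : G.IsTree) (d : B → B → ℤ)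
    (hd : ∀ a b, G.Adj a b → d b a = - d a b) :
    ∃ g : B → ℤ, ∀ a b, G.Adj a b → g b = g a + d a b := by
  classical
  obtain ⟨r⟩ := hG.connected.nonempty
  have hex : ∀ v, ∃ p : G.Walk r v, p.IsPath := fun v => (hG.existsUnique_path r v).exists
  choose P hP using hex
  let wt : ∀ u v : B, G.Walk u v → ℤ := fun u v p => (p.darts.map fun e => d e.fst e.snd).sum
  have key : ∀ a b (h : G.Adj a b), a ∈ (P b).support → wt r b (P b) = wt r a (P a) + d a b := by
    intro a b h ha
    rw [hG.isAcyclic.path_concat (hP a) (hP b) h ha]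
    simp [wt, SimpleGraph.Walk.darts_concat]
  refine ⟨fun v => wt r v (P v), ?_⟩
  intro a b h
  by_cases ha : a ∈ (P b).support
  · exact key a b h ha
  · have hb := hG.isAcyclic.mem_support_of_ne_mem_support_of_adj_of_isPath (hP a) (hP b) h ha
    have := key b a h.symm hb
    simp only [this, hd a b h]
    ring

/-- Bridge lemma. -/
lemma tree_bridge {G : SimpleGraph B} (hG : G.IsTree) {a b : B} (hab : G.Adj a b) :
    ∃ g : B → ℤ, g a ≠ g b ∧ ∀ u v, G.Adj u v → ¬ (u = a ∧ v = b) → ¬ (u = b ∧ v = a) →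
      g u = g v := by
  classical
  obtain ⟨g, hg⟩ := tree_potential hG
    (fun u v => if u = a ∧ v = b then 1 else if u = b ∧ v = a then -1 else 0) (by
      intro u v huv
      have := hab.ne
      by_cases h1 : u = a ∧ v = b
      · obtain ⟨rfl, rfl⟩ := h1
        simp [this.symm]
      · by_cases h2 : u = b ∧ v = a
        · obtain ⟨rfl, rfl⟩ := h2
          simp [this.symm]
        · simp [h1, h2, and_comm])
  refine ⟨g, ?_, ?_⟩
  · rw [hg a b hab]; simp
  · intro u v huv h1 h2
    rw [hg u v huv]; simp [h1, h2]

/-- `p 0, …, p L` is a path. -/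
def IsP (G : SimpleGraph B) (p : ℕ → B) (L : ℕ) : Prop :=
  (∀ i < L, G.Adj (p i) (p (i + 1))) ∧ ∀ i ≤ L, ∀ j ≤ L, p i = p j → i = j

lemma const_along {G : SimpleGraph B} {p : ℕ → B} {L : ℕ} (_hp : IsP G p L) (g : B → ℤ) (i j : ℕ)
    (hij : i ≤ j) (hj : j ≤ L) (hg : ∀ k, i ≤ k → k < j → g (p k) = g (p (k + 1))) :
    g (p i) = g (p j) := by
  induction j, hij using Nat.le_induction with
  | base => rfl
  | succ j hij ih =>
    rw [ih (by omega) (fun k h1 h2 => hg k h1 (by omega))]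
    exact hg j hij (by omega)

lemma IsP.reverse {G : SimpleGraph B} {p : ℕ → B} {L : ℕ} (hp : IsP G p L) :
    IsP G (fun i => p (L - i)) L := by
  constructor
  · intro i hi
    have := hp.1 (L - (i + 1)) (by omega)
    rw [show L - (i + 1) + 1 = L - i by omega] at this
    exact this.symm
  · intro i hi j hj h
    have := hp.2 (L - i) (by omega) (L - j) (by omega) h
    omega

/-- Longest paths in spider-free trees dominate, so there is a caterpillar numbering. -/
lemma extend_lt {G : SimpleGraph B} {p : ℕ → B} {L : ℕ} (hp : IsP G p L)
    (hmax : ∀ q L', IsP G q L' → L' ≤ L) {u v : B} {i : ℕ} (hi : i ≤ L)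
    (hu : ∀ k ≤ L, p k ≠ u) (hv : ∀ k ≤ L, p k ≠ v) (h1 : G.Adj (p i) u) (h2 : G.Adj u v) :
    i + 2 ≤ L := by
  refine hmax (fun k => if k ≤ i then p k else if k = i + 1 then u else v) (i + 2) ⟨?_, ?_⟩
  · intro k hk
    rcases Nat.lt_trichotomy k i with h | h | h
    · simp only [h.le, show k + 1 ≤ i by omega, if_true]
      exact hp.1 k (by omega)
    · subst h; simpa using h1
    · obtain rfl : k = i + 1 := by omega
      simpa using h2
  · intro j hj k hk hjk
    have huv := h2.ne
    have hinj := hp.2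
    by_cases a1 : j ≤ i <;> by_cases a2 : k ≤ i <;> by_cases a3 : j = i + 1 <;>
      by_cases a4 : k = i + 1 <;> simp only [a1, a2, a3, a4, if_true, if_false] at hjk <;>
      first
      | omega
      | exact hinj j (by omega) k (by omega) hjk
      | exact absurd hjk (hu _ (by omega))
      | exact absurd hjk (hv _ (by omega))
      | exact absurd hjk.symm (hu _ (by omega))
      | exact absurd hjk.symm (hv _ (by omega))
      | exact absurd hjk huv
      | exact absurd hjk.symm huv
      | (simp at hjk
         first
         | omega
         | exact absurd hjk huv
         | exact absurd hjk.symm huv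
         | exact absurd hjk (hu _ (by omega))
         | exact absurd hjk (hv _ (by omega))
         | exact absurd hjk.symm (hu _ (by omega))
         | exact absurd hjk.symm (hv _ (by omega)))

lemma caterpillar [Fintype B] {G : SimpleGraph B} (hG : G.IsTree)
    (hsp : ∀ z a a' b b' c c' : B, [z, a, a', b, b', c, c'].Nodup → G.Adj z a → G.Adj a a' →
      G.Adj z b → G.Adj b b' → G.Adj z c → G.Adj c c' → False) :
    ∃ (sp : B → Prop) (pos : B → ℤ),
      (∀ u v, sp u → sp v → pos u = pos v → u = v) ∧
      (∀ u v, G.Adj u v → sp u → sp v → pos v = pos u + 1 ∨ pos v = pos u - 1) ∧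
      (∀ u v, G.Adj u v → sp u → ¬ sp v → pos v = pos u) ∧
      (∀ u v, G.Adj u v → sp u ∨ sp v) := by
  classical
  obtain ⟨r⟩ := hG.connected.nonempty
  have hbd : ∀ p L, IsP G p L → L + 1 ≤ Fintype.card B := by
    intro p L hp
    have hinj : Function.Injective (fun i : Fin (L + 1) => p i) := by
      intro i j h
      exact Fin.ext (hp.2 i (by omega) j (by omega) h)
    simpa using Fintype.card_le_of_injective _ hinj
  obtain ⟨L, p, hp, hmax⟩ : ∃ L p, IsP G p L ∧ ∀ q L', IsP G q L' → L' ≤ L := by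
    let Q : ℕ → Prop := fun L => ∃ p, IsP G p L
    have hQ0 : Q 0 := ⟨fun _ => r, by constructor <;> intros <;> omega⟩
    obtain ⟨p, hp⟩ : Q (Nat.findGreatest Q (Fintype.card B)) :=
      Nat.findGreatest_spec (Nat.zero_le _) hQ0
    refine ⟨_, p, hp, ?_⟩
    intro q L' hq
    exact Nat.le_findGreatest (by have := hbd q L' hq; omega) ⟨q, hq⟩
  let sp : B → Prop := fun v => ∃ i ≤ L, p i = v
  -- domination
  have hdom : ∀ v, sp v ∨ ∃ i ≤ L, G.Adj (p i) v := by
    by_contra! hcon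
    obtain ⟨v, hv1, hv2⟩ := hcon
    obtain ⟨w⟩ := hG.connected.preconnected (p 0) v
    obtain ⟨e, -, he1, he2⟩ := w.exists_boundary_dart {v | sp v ∨ ∃ i ≤ L, G.Adj (p i) v}
      (Or.inl ⟨0, by omega, rfl⟩) (by
        rintro (h | ⟨i, hi, h⟩)
        · exact hv1 h
        · exact hv2 i hi h)
    have hadj := e.adj
    generalize e.fst = u at *
    generalize e.snd = x at *
    simp only [Set.mem_ofPred_eq, not_or, not_exists, not_and] at he1 he2
    have hus : ¬ sp u := by
      rintro ⟨i, hi, rfl⟩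
      exact he2.2 i hi hadj
    obtain ⟨i, hi, hiu⟩ := he1.resolve_left hus
    have hu : ∀ k ≤ L, p k ≠ u := fun k hk h => hus ⟨k, hk, h⟩
    have hx : ∀ k ≤ L, p k ≠ x := fun k hk h => he2.1 ⟨k, hk, h⟩
    have b1 := extend_lt hp hmax hi hu hx hiu hadj
    have b2 := extend_lt (i := L - i) hp.reverse hmax (by omega) (fun k hk => hu _ (by omega))
      (fun k hk => hx _ (by omega)) (by rwa [show L - (L - i) = i by omega]) hadj
    have hi2 : 2 ≤ i := by omega
    refine hsp (p i) (p (i - 1)) (p (i - 2)) (p (i + 1)) (p (i + 2)) u x ?_ ?_ ?_ (hp.1 i (by omega))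
      (hp.1 (i + 1) (by omega)) hiu hadj
    · have hne : ∀ j ≤ L, ∀ k ≤ L, j ≠ k → p j ≠ p k := fun j hj k hk hjk h =>
        hjk (hp.2 j hj k hk h)
      simp only [List.nodup_cons, List.mem_cons, List.not_mem_nil, not_or, or_false,
        List.nodup_nil, not_false_eq_true, and_true]
      refine ⟨⟨?_, ?_, ?_, ?_, ?_, ?_⟩, ⟨?_, ?_, ?_, ?_, ?_⟩, ⟨?_, ?_, ?_, ?_⟩,
        ⟨?_, ?_, ?_⟩, ⟨?_, ?_⟩, ?_⟩
      all_goals first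
        | exact hadj.ne
        | exact hne _ (by omega) _ (by omega) (by omega)
        | exact hu _ (by omega)
        | exact hx _ (by omega)
    · have := (hp.1 (i - 1) (by omega)).symm
      rwa [show i - 1 + 1 = i by omega] at this
    · have := (hp.1 (i - 2) (by omega)).symm
      rwa [show i - 2 + 1 = i - 1 by omega] at this
  -- constancy along the path
  have hcst : ∀ g : B → ℤ, (∀ k < L, g (p k) = g (p (k + 1))) → ∀ i ≤ L, ∀ j ≤ L,
      g (p i) = g (p j) := by
    intro g hg i hi j hj
    rcases le_total i j with h | h
    · exact const_along hp g i j h hj (fun k _ _ => hg k (by omega))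
    · exact (const_along hp g j i h hi (fun k _ _ => hg k (by omega))).symm
  have hstep : ∀ i j, i < j → j ≤ L → G.Adj (p i) (p j) → j = i + 1 := by
    intro i j hij hj hadj
    by_contra hne
    obtain ⟨g, hg1, hg2⟩ := tree_bridge hG hadj
    apply hg1
    refine const_along hp g i j hij.le hj fun k h1 h2 => hg2 _ _ (hp.1 k (by omega)) ?_ ?_
    · rintro ⟨e1, e2⟩
      have := hp.2 _ (by omega) _ (by omega) e1
      have := hp.2 _ (by omega) _ (by omega) e2
      omega
    · rintro ⟨e1, e2⟩
      have := hp.2 _ (by omega) _ (by omega) e1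
      have := hp.2 _ (by omega) _ (by omega) e2
      omega
  have hoff1 : ∀ v, ¬ sp v → ∀ i ≤ L, ∀ j ≤ L, G.Adj (p i) v → G.Adj (p j) v → i = j := by
    intro v hv i hi j hj h1 h2
    by_contra hne
    obtain ⟨g, hg1, hg2⟩ := tree_bridge hG h1
    have hv' : ∀ k ≤ L, p k ≠ v := fun k hk h => hv ⟨k, hk, h⟩
    apply hg1
    rw [← hg2 _ _ h2 (fun h => hne (hp.2 _ hi _ hj h.1.symm)) (fun h => hv' j hj h.1)]
    exact hcst g (fun k hk => hg2 _ _ (hp.1 k hk) (fun h => hv' _ (by omega) h.2)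
      (fun h => hv' _ (by omega) h.1)) i hi j hj
  have hoff2 : ∀ u v, G.Adj u v → sp u ∨ sp v := by
    intro u v huv
    by_contra! hcon
    obtain ⟨hu, hv⟩ := hcon
    obtain ⟨i, hi, hiu⟩ := (hdom u).resolve_left hu
    obtain ⟨j, hj, hjv⟩ := (hdom v).resolve_left hv
    have hu' : ∀ k ≤ L, p k ≠ u := fun k hk h => hu ⟨k, hk, h⟩
    have hv' : ∀ k ≤ L, p k ≠ v := fun k hk h => hv ⟨k, hk, h⟩
    obtain ⟨g, hg1, hg2⟩ := tree_bridge hG huv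
    apply hg1
    rw [← hg2 _ _ hiu (fun h => hu' i hi h.1) (fun h => hv' i hi h.1),
      ← hg2 _ _ hjv (fun h => hu' j hj h.1) (fun h => hv' j hj h.1)]
    exact hcst g (fun k hk => hg2 _ _ (hp.1 k hk) (fun h => hu' _ (by omega) h.1)
      (fun h => hv' _ (by omega) h.1)) i hi j hj
  have hidx : ∀ v, ∃ i ≤ L, (sp v → p i = v) ∧ (¬ sp v → G.Adj (p i) v) := by
    intro v
    rcases hdom v with ⟨i, hi, h⟩ | ⟨i, hi, h⟩
    · exact ⟨i, hi, fun _ => h, fun h' => absurd ⟨i, hi, h⟩ h'⟩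
    · by_cases hs : sp v
      · obtain ⟨j, hj, hjv⟩ := hs
        exact ⟨j, hj, fun _ => hjv, fun h' => absurd ⟨j, hj, hjv⟩ h'⟩
      · exact ⟨i, hi, fun h' => absurd h' hs, fun _ => h⟩
  choose ix hixL hix1 hix2 using hidx
  refine ⟨sp, fun v => (ix v : ℤ), ?_, ?_, ?_, hoff2⟩
  · intro u v hu hv h
    have : ix u = ix v := by simpa using h
    rw [← hix1 u hu, ← hix1 v hv, this]
  · intro u v huv hu hv
    have e1 := hix1 u hu
    have e2 := hix1 v hv
    rw [← e1, ← e2] at huv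
    rcases Nat.lt_trichotomy (ix u) (ix v) with h | h | h
    · left
      have := hstep _ _ h (hixL v) huv
      show (ix v : ℤ) = ix u + 1
      omega
    · rw [h] at huv; exact absurd rfl huv.ne
    · right
      have := hstep _ _ h (hixL u) huv.symm
      show (ix v : ℤ) = ix u - 1
      omega
  · intro u v huv hu hv
    have e1 := hix1 u hu
    rw [← e1] at huv
    have := hoff1 v hv _ (hixL v) _ (hixL u) (hix2 v hv) huv
    show (ix v : ℤ) = ix u
    omega

/-- Vertex-disjoint synchronous walks on a caterpillar cannot change order; hence a simple
cycle of the cover winds exactly once. -/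
lemma wind_once [Fintype B] {G : SimpleGraph B} (hG : G.IsTree)
    (hsp : ∀ z a a' b b' c c' : B, [z, a, a', b, b', c, c'].Nodup → G.Adj z a → G.Adj a a' →
      G.Adj z b → G.Adj b b' → G.Adj z c → G.Adj c c' → False)
    (x : ℕ → B) (hx : ∀ i, G.Adj (x i) (x (i + 1))) (h w : ℕ) (hw : 0 < w)
    (hper : ∀ i, x (i + 2 * h * w) = x i) 
    (hinj : ∀ i, x (i + 2 * h) = x i → w = 1) : w = 1 := by
  classical
  by_contra hw1
  have hne : ∀ i, x (i + 2 * h) ≠ x i := fun i hi => hw1 (hinj i hi)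
  obtain ⟨sp, pos, c1, c2, c3, c4⟩ := caterpillar hG hsp
  let col : B → ℤ := fun v => if sp v then pos v else pos v + 1
  let q : B → ℤ := fun v => if sp v then 4 * pos v else 4 * pos v + 3
  have hcol : ∀ u v, G.Adj u v → (col u + col v) % 2 = 1 := by
    intro u v huv
    have d4 := c4 u v huv
    by_cases hu : sp u <;> by_cases hv : sp v <;> simp only [col, hu, hv, if_true, if_false]
    · have := c2 u v huv hu hv; omega
    · have := c3 u v huv hu hv; omega
    · have := c3 v u huv.symm hv hu; omega
    · simp [hu, hv] at d4
  have hcol2 : ∀ i j, (col (x (i + j)) - col (x i) - j) % 2 = 0 := by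
    intro i j
    induction j with
    | zero => simp
    | succ j ih =>
      have := hcol _ _ (hx (i + j))
      rw [← add_assoc]; push_cast; omega
  have hqc : ∀ u v u' v', G.Adj u u' → G.Adj v v' → u ≠ v → u' ≠ v' → (col u - col v) % 2 = 0 →
      q u ≠ q v ∧ (q u < q v → q u' < q v') := by
    intro u v u' v' huu hvv huv huv2 hc
    have e1 := c1 u v
    have e2 := c1 u' v'
    have f1 := c2 u u' huu
    have f2 := c3 u u' huu
    have f3 := c4 u u' huu
    have f4 := c3 u' u huu.symm
    have k1 := c2 v v' hvv
    have k2 := c3 v v' hvv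
    have k3 := c4 v v' hvv
    have k4 := c3 v' v hvv.symm
    by_cases s1 : sp u <;> by_cases s2 : sp v <;> by_cases s3 : sp u' <;> by_cases s4 : sp v' <;>
      simp only [s1, s2, s3, s4, q, col, if_true, if_false, true_imp_iff, false_imp_iff,
        not_true, not_false_eq_true, or_false, or_true, huv, huv2, imp_false, or_self] at * <;>
      omega
  have hdich : (∀ i, q (x i) < q (x (i + 2 * h))) ∨ (∀ i, q (x (i + 2 * h)) < q (x i)) := by
    have hc1 : ∀ i, (col (x i) - col (x (i + 2 * h))) % 2 = 0 := by
      intro i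
      have := hcol2 i (2 * h)
      push_cast at this; omega
    have hadd : ∀ i, i + 1 + 2 * h = i + 2 * h + 1 := fun i => by omega
    have A : ∀ i, q (x i) < q (x (i + 2 * h)) → q (x (i + 1)) < q (x (i + 1 + 2 * h)) := by
      intro i
      refine (hqc _ _ _ _ (hx i) ?_ (hne i).symm (hne (i + 1)).symm (hc1 i)).2
      rw [hadd]; exact hx _
    have A' : ∀ i, q (x (i + 2 * h)) < q (x i) → q (x (i + 1 + 2 * h)) < q (x (i + 1)) := by
      intro i
      refine (hqc _ _ _ _ ?_ (hx i) (hne i) (hne (i + 1)) (by have := hc1 i; omega)).2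
      rw [hadd]; exact hx _
    have C : q (x 0) ≠ q (x (0 + 2 * h)) :=
      (hqc _ _ _ _ (hx 0) (hx _) (hne 0).symm (by
        have := (hne 1).symm; rwa [show 1 + 2 * h = 0 + 2 * h + 1 by omega] at this) (hc1 0)).1
    rcases lt_or_gt_of_ne C with hlt | hlt
    · left
      intro i
      induction i with
      | zero => exact hlt
      | succ i ih => exact A i ih
    · right
      intro i
      induction i with
      | zero => exact hlt
      | succ i ih => exact A' i ih
  have hlast := hper 0
  rcases hdich with hd | hd
  · have : ∀ j, 0 < j → q (x 0) < q (x (0 + 2 * h * j)) := by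
      intro j hj
      induction j, hj using Nat.le_induction with
      | base => simpa using hd 0
      | succ j hj ih =>
        have := hd (0 + 2 * h * j)
        rw [show 0 + 2 * h * (j + 1) = 0 + 2 * h * j + 2 * h by ring]
        exact ih.trans this
    have := this w hw
    rw [hlast] at this
    exact lt_irrefl _ this
  · have : ∀ j, 0 < j → q (x (0 + 2 * h * j)) < q (x 0) := by
      intro j hj
      induction j, hj using Nat.le_induction with
      | base => simpa using hd 0
      | succ j hj ih =>
        have := hd (0 + 2 * h * j)
        rw [show 0 + 2 * h * (j + 1) = 0 + 2 * h * j + 2 * h by ring]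
        exact this.trans ih
    have := this w hw
    rw [hlast] at this
    exact lt_irrefl _ this

end comb

section cover
variable {B V : Type*}

/-- Abstract description of the `2`-cover by labels and times. -/
structure Cov (G : SimpleGraph B) (h : ℕ) (τ : B → ℤ) (lbl : V → B) (T : V → ZMod (2 * h))
    (E : V → V → Prop) : Prop where
  hpos : 0 < h
  inj : ∀ x y, lbl x = lbl y → T x = T y → x = y
  ex : ∀ s (k : ℤ), (k - τ s) % 2 = 0 → ∃ x, lbl x = s ∧ T x = (k : ZMod (2 * h))
  par : ∀ x (k : ℤ), T x = (k : ZMod (2 * h)) → (k - τ (lbl x)) % 2 = 0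
  edge : ∀ x y, E x y ↔ G.Adj (lbl x) (lbl y) ∧ T y = T x + 1
  tau : ∀ a b, G.Adj a b → (τ a + τ b) % 2 = 1

/-- An orientation of the graph. -/
def IsOrient (G : SimpleGraph B) (o : B → B → Prop) : Prop :=
  (∀ a b, o a b → G.Adj a b) ∧ (∀ a b, G.Adj a b → o a b ∨ o b a) ∧ ∀ a b, ¬ (o a b ∧ o b a)

lemma crossing (h : ℕ) (hh : 0 < h) (K : ℕ → ℤ) (hstep : ∀ i, K (i + 1) = K i ∨ K (i + 1) = K i + 1)
    (hper : ∀ i, K (i + 2 * h) = K i + h) :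
    ∃ i < 2 * h, (K (i + 1) = K i + 1 ∧ (h : ℤ) ∣ K i) ∧
      ∀ j < 2 * h, (K (j + 1) = K j + 1 ∧ (h : ℤ) ∣ K j) → j = i := by
  have hmono : Monotone K := monotone_nat_of_le_succ (fun i => by
    rcases hstep i with h | h <;> omega)
  have huniq : ∀ i j, i < j → j < 2 * h → (K (i + 1) = K i + 1 ∧ (h : ℤ) ∣ K i) →
      (K (j + 1) = K j + 1 ∧ (h : ℤ) ∣ K j) → False := by
    rintro i j hij hj ⟨h1, h2⟩ ⟨h3, h4⟩
    have a1 := hmono (show i + 1 ≤ j by omega)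
    have a2 := hmono (show j + 1 ≤ i + 2 * h by omega)
    rw [hper i] at a2
    have := Int.le_of_dvd (by omega) (Int.dvd_sub h4 h2)
    omega
  obtain ⟨c, hc1, hc2, hc3⟩ : ∃ c : ℤ, (h : ℤ) ∣ c ∧ K 0 ≤ c ∧ c < K 0 + h := by
    refine ⟨K 0 + (-K 0) % h, ?_, ?_, ?_⟩
    · have := Int.dvd_self_sub_emod (x := -K 0) (m := h)
      have h2 := (Int.dvd_neg).mpr this
      convert h2 using 1; ring
    · have := Int.emod_nonneg (-K 0) (show (h : ℤ) ≠ 0 by omega); omega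
    · have := Int.emod_lt_of_pos (-K 0) (show (0 : ℤ) < h by omega); omega
  have hex : ∃ i, c < K i := ⟨0 + 2 * h, by rw [hper]; omega⟩
  classical
  have h1 := Nat.find_spec hex
  have h2 : Nat.find hex ≤ 0 + 2 * h := Nat.find_min' hex (by rw [hper]; omega)
  have h0 : Nat.find hex ≠ 0 := by
    intro h0; rw [h0] at h1; omega
  obtain ⟨i, hi⟩ := Nat.exists_eq_succ_of_ne_zero h0
  have h3 := Nat.find_min hex (show i < Nat.find hex by omega)
  rw [hi] at h1 h2
  have h4 := hstep i
  have e : K i = c ∧ K (i + 1) = K i + 1 := by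
    simp only [Nat.succ_eq_add_one] at h1; omega
  refine ⟨i, by omega, ⟨e.2, e.1 ▸ hc1⟩, ?_⟩
  intro j hj hj2
  rcases Nat.lt_trichotomy i j with hl | hl | hl
  · exact (huniq i j hl hj ⟨e.2, e.1 ▸ hc1⟩ hj2).elim
  · exact hl.symm
  · exact (huniq j i hl (by omega) hj2 ⟨e.2, e.1 ▸ hc1⟩).elim

/-- Height potential of an orientation. -/
lemma orient_potential {G : SimpleGraph B} (hG : G.IsTree) {o : B → B → Prop} (ho : IsOrient G o) :
    ∃ P : B → ℤ, ∀ a b, o a b → P b = P a - 1 := by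
  classical
  obtain ⟨P, hP⟩ := tree_potential hG (fun a b => if o a b then -1 else 1) (by
    intro a b hab
    have h1 := ho.2.1 a b hab
    have h2 := ho.2.2 a b
    by_cases h3 : o a b <;> by_cases h4 : o b a <;> simp_all)
  refine ⟨P, fun a b hab => ?_⟩
  rw [hP a b (ho.1 a b hab)]
  simp [hab]; ring

variable {G : SimpleGraph B} {h : ℕ} {τ : B → ℤ} {lbl : V → B} {T : V → ZMod (2 * h)}
    {E : V → V → Prop}

/-- The cut path with orientation `o` through the vertex `x0`. -/
def kap (lbl : V → B) (T : V → ZMod (2 * h)) (E : V → V → Prop) (o : B → B → Prop) (P : B → ℤ)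
    (x0 : V) : Set (V × V) :=
  {p | E p.1 p.2 ∧ o (lbl p.1) (lbl p.2) ∧ T p.1 = T x0 + ((P (lbl p.1) - P (lbl x0) : ℤ) : ZMod (2 * h))}

lemma conn_const {α : Type*} (hG : G.Connected) (F : B → α) (hF : ∀ a b, G.Adj a b → F a = F b)
    (a b : B) : F a = F b := by
  obtain ⟨p⟩ := hG.preconnected a b
  induction p with
  | nil => rfl
  | cons h p ih => exact (hF _ _ h).trans ih

lemma kap_cut [Fintype B] (hG : G.IsTree)
    (hsp : ∀ z a a' b b' c c' : B, [z, a, a', b, b', c, c'].Nodup → G.Adj z a → G.Adj a a' →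
      G.Adj z b → G.Adj b b' → G.Adj z c → G.Adj c c' → False)
    (C : Cov G h τ lbl T E) {o : B → B → Prop} (ho : IsOrient G o) (P : B → ℤ)
    (hP : ∀ a b, o a b → P b = P a - 1) (x0 : V) : IsCutPath E (kap lbl T E o P x0) := by
  refine ⟨fun p hp => hp.1, ?_⟩
  intro m hm f hf hE
  have hh := C.hpos
  have : NeZero m := ⟨by omega⟩
  let x : ℕ → B := fun i => lbl (f (i : ZMod m))
  have hE' : ∀ i : ℕ, E (f (i : ZMod m)) (f ((i + 1 : ℕ) : ZMod m)) := by
    intro i; have := hE (i : ZMod m); push_cast; exact this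
  have hx : ∀ i, G.Adj (x i) (x (i + 1)) := fun i => ((C.edge _ _).mp (hE' i)).1
  have hT : ∀ i : ℕ, T (f (i : ZMod m)) = T (f 0) + (i : ZMod (2 * h)) := by
    intro i
    induction i with
    | zero => simp
    | succ i ih => rw [((C.edge _ _).mp (hE' i)).2, ih]; push_cast; ring
  have hdvd : 2 * h ∣ m := by
    have := hT m
    rw [ZMod.natCast_self] at this
    rw [← ZMod.natCast_eq_zero_iff]
    exact (left_eq_add.mp this)
  obtain ⟨w, hw⟩ := hdvd
  have hw0 : 0 < w := by
    rcases Nat.eq_zero_or_pos w with h0 | h0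
    · subst h0; omega
    · exact h0
  have hw1 : w = 1 := by
    refine wind_once hG hsp x hx h w hw0 ?_ ?_
    · intro i
      simp only [x]
      rw [← hw]; simp
    · intro i hi
      have h1 : f ((i + 2 * h : ℕ) : ZMod m) = f (i : ZMod m) := by
        refine C.inj _ _ hi ?_
        rw [hT, hT]
        have : ((2 * h : ℕ) : ZMod (2 * h)) = 0 := ZMod.natCast_self _
        rw [Nat.cast_add, this]; simp
      have h2 := hf h1
      rw [Nat.cast_add, add_eq_left, ZMod.natCast_eq_zero_iff, hw] at h2
      have h3 := Nat.le_of_dvd (by omega) h2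
      nlinarith
  rw [hw1, mul_one] at hw
  subst hw
  obtain ⟨t0, ht0⟩ := ZMod.intCast_surjective (T (f 0))
  obtain ⟨θ, hθ⟩ := ZMod.intCast_surjective (T x0)
  let H : ℕ → ℤ := fun i => t0 + i - P (x i) - (θ - P (lbl x0))
  have hPstep : ∀ a b, G.Adj a b → (P a - τ a) % 2 = (P b - τ b) % 2 := by
    intro a b hab
    have h1 := C.tau a b hab
    rcases ho.2.1 a b hab with h2 | h2
    · have := hP _ _ h2; omega
    · have := hP _ _ h2; omega
  have hPar : ∀ a b, (P a - τ a) % 2 = (P b - τ b) % 2 :=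
    conn_const hG.connected (fun a => (P a - τ a) % 2) hPstep
  have heven : ∀ i, ∃ k, H i = 2 * k := by
    intro i
    have h1 := C.par (f (i : ZMod (2 * h))) (t0 + i) (by rw [hT, ← ht0]; push_cast; rfl)
    have h2 := C.par x0 θ hθ.symm
    have h3 := hPar (x i) (lbl x0)
    refine ⟨H i / 2, ?_⟩
    simp only [H, x] at *
    omega
  choose K hK using heven
  have hstepo : ∀ i, o (x i) (x (i + 1)) → K (i + 1) = K i + 1 := by
    intro i hi
    have := hP _ _ hi
    have e1 := hK i
    have e2 := hK (i + 1)
    simp only [H] at e1 e2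
    push_cast at e2
    omega
  have hstepo' : ∀ i, ¬ o (x i) (x (i + 1)) → K (i + 1) = K i := by
    intro i hi
    have := hP _ _ ((ho.2.1 _ _ (hx i)).resolve_left hi)
    have e1 := hK i
    have e2 := hK (i + 1)
    simp only [H] at e1 e2
    push_cast at e2
    omega
  have hper : ∀ i, K (i + 2 * h) = K i + h := by
    intro i
    have e1 := hK i
    have e2 := hK (i + 2 * h)
    have e3 : x (i + 2 * h) = x i := by
      simp only [x]; rw [Nat.cast_add, ZMod.natCast_self, add_zero]
    simp only [H, e3] at e1 e2
    push_cast at e2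
    omega
  have hiff : ∀ i : ℕ, (f (i : ZMod (2 * h)), f ((i : ZMod (2 * h)) + 1)) ∈ kap lbl T E o P x0 ↔
      (K (i + 1) = K i + 1 ∧ (h : ℤ) ∣ K i) := by
    intro i
    have hx1 : lbl (f ((i : ZMod (2 * h)) + 1)) = x (i + 1) := by simp [x]
    have hTi : T (f (i : ZMod (2 * h))) =
        T x0 + ((P (lbl (f (i : ZMod (2 * h)))) - P (lbl x0) : ℤ) : ZMod (2 * h)) ↔ (h : ℤ) ∣ K i := by
      rw [hT, ← ht0, ← hθ]
      have : ((t0 : ℤ) : ZMod (2 * h)) + (i : ZMod (2 * h)) = ((t0 + i : ℤ) : ZMod (2 * h)) := by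
        push_cast; rfl
      rw [this, ← Int.cast_add, eq_comm, ZMod.intCast_eq_intCast_iff_dvd_sub]
      have e1 : t0 + ↑i - (θ + (P (lbl (f ↑i)) - P (lbl x0))) = 2 * K i := by
        rw [← hK i]; simp only [H, x]; ring
      rw [e1]
      push_cast
      exact mul_dvd_mul_iff_left (by norm_num)
    simp only [kap, Set.mem_ofPred_eq, hTi, hx1]
    constructor
    · rintro ⟨-, h2, h3⟩
      exact ⟨hstepo i h2, h3⟩
    · rintro ⟨h2, h3⟩
      refine ⟨hE _, ?_, h3⟩
      by_contra hcon
      have := hstepo' i hcon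
      omega
  obtain ⟨i, hi, hi2, hi3⟩ := crossing h hh K (fun i => by
    by_cases hoi : o (x i) (x (i + 1))
    · exact Or.inr (hstepo i hoi)
    · exact Or.inl (hstepo' i hoi)) hper
  refine ⟨(i : ZMod (2 * h)), (hiff i).mpr hi2, ?_⟩
  intro j hj
  have hj' : ((j.val : ℕ) : ZMod (2 * h)) = j := ZMod.natCast_zmod_val j
  rw [← hj']
  rw [← hj'] at hj
  rw [hi3 j.val (ZMod.val_lt j) ((hiff _).mp hj)]

/-- `κ` contains an edge from label `a` at time `t` to label `b`. -/
def Hit (lbl : V → B) (T : V → ZMod (2 * h)) (κ : Set (V × V)) (a b : B) (t : ZMod (2 * h)) : Prop :=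
  ∃ x y, (x, y) ∈ κ ∧ lbl x = a ∧ lbl y = b ∧ T x = t

lemma val_succ_mod (hh : 0 < h) (i : ZMod (2 * h)) : (i + 1).val % 2 = (i.val + 1) % 2 := by
  have : NeZero (2 * h) := ⟨by omega⟩
  rw [ZMod.val_add, Nat.mod_mod_of_dvd _ (Dvd.intro _ rfl)]
  rcases Nat.lt_or_ge 1 (2 * h) with h1 | h1
  · have : Fact (1 < 2 * h) := ⟨h1⟩
    rw [ZMod.val_one]
  · omega

lemma val_int_mod (hh : 0 < h) (k : ℤ) : (((k : ZMod (2 * h)).val : ℕ) : ℤ) % 2 = k % 2 := by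
  have : NeZero (2 * h) := ⟨by omega⟩
  rw [ZMod.val_intCast]
  exact Int.emod_emod_of_dvd _ (by push_cast; exact Dvd.intro _ rfl)

lemma zigzag (C : Cov G h τ lbl T E) {κ : Set (V × V)} (hκ : IsCutPath E κ) (s : B)
    (c : ZMod (2 * h) → B) (hc : ∀ t, G.Adj s (c t)) :
    ∃ i : ZMod (2 * h),
      (i.val % 2 = 0 → Hit lbl T κ s (c (τ s + i)) (τ s + i)) ∧
      (i.val % 2 = 1 → Hit lbl T κ (c (τ s + i - 1)) s (τ s + i)) ∧
      (∀ t, Hit lbl T κ s (c t) t → t = τ s + i ∧ i.val % 2 = 0) ∧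
      (∀ t, Hit lbl T κ (c (t - 1)) s t → t = τ s + i ∧ i.val % 2 = 1) := by
  classical
  have hh := C.hpos
  have : NeZero (2 * h) := ⟨by omega⟩
  have hg : ∀ i : ZMod (2 * h), ∃ x, lbl x = (if i.val % 2 = 0 then s else c (τ s + i - 1)) ∧
      T x = τ s + i := by
    intro i
    obtain ⟨x, hx1, hx2⟩ := C.ex (if i.val % 2 = 0 then s else c (τ s + i - 1)) (τ s + i.val) (by
      split_ifs with hi
      · omega
      · have := C.tau _ _ (hc (τ s + i - 1))
        omega)
    refine ⟨x, hx1, ?_⟩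
    rw [hx2]; push_cast
    rw [ZMod.natCast_zmod_val]
  choose g hg1 hg2 using hg
  have ginj : Function.Injective g := by
    intro i j hij
    have := hg2 i
    rw [hij, hg2 j] at this
    exact (add_left_cancel this).symm
  have gE : ∀ i, E (g i) (g (i + 1)) := by
    intro i
    rw [C.edge, hg1, hg1, hg2, hg2, val_succ_mod hh]
    refine ⟨?_, by ring⟩
    by_cases hi : i.val % 2 = 0
    · rw [if_pos hi, if_neg (by omega)]; exact hc _
    · rw [if_neg hi, if_pos (by omega)]; exact (hc _).symm
  obtain ⟨i, hi1, hi2⟩ := hκ.2 (2 * h) (by omega) g ginj gE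
  have hmem : ∀ j x y, (x, y) ∈ κ → lbl x = lbl (g j) → lbl y = lbl (g (j + 1)) → T x = T (g j) →
      j = i := by
    intro j x y hxy h1 h2 h3
    have ex : x = g j := C.inj _ _ h1 h3
    have hy := ((C.edge _ _).mp (hκ.1 _ hxy)).2
    have ey : y = g (j + 1) := C.inj _ _ h2 (by rw [hy]; simp only [h3, hg2]; ring)
    subst ex ey
    exact hi2 j hxy
  have hsucc := val_succ_mod hh i
  refine ⟨i, ?_, ?_, ?_, ?_⟩
  · intro he
    refine ⟨_, _, hi1, ?_, ?_, hg2 i⟩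
    · rw [hg1, if_pos he]
    · rw [hg1, if_neg (by omega)]; congr 1; ring
  · intro he
    refine ⟨_, _, hi1, ?_, ?_, hg2 i⟩
    · rw [hg1, if_neg (by omega)]
    · rw [hg1, if_pos (by omega)]
  · rintro t ⟨x, y, hxy, h1, h2, h3⟩
    obtain ⟨k, hk⟩ := ZMod.intCast_surjective (T x)
    have hp := C.par x k hk.symm
    rw [h1] at hp
    have hj : ((k - τ s : ℤ) : ZMod (2 * h)).val % 2 = 0 := by
      have := val_int_mod hh (k - τ s); omega
    have ht : t = τ s + ((k - τ s : ℤ) : ZMod (2 * h)) := by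
      rw [← h3, ← hk]; push_cast; ring
    have hj1 := val_succ_mod hh ((k - τ s : ℤ) : ZMod (2 * h))
    have := hmem ((k - τ s : ℤ) : ZMod (2 * h)) x y hxy (by rw [hg1, if_pos hj, h1])
      (by rw [hg1, if_neg (by omega), h2, ht]; congr 1; ring) (by rw [hg2, h3, ht])
    rw [← this]
    exact ⟨ht, hj⟩
  · rintro t ⟨x, y, hxy, h1, h2, h3⟩
    obtain ⟨k, hk⟩ := ZMod.intCast_surjective (T x)
    have hp := C.par x k hk.symm
    rw [h1] at hp
    have htau := C.tau _ _ (hc (t - 1))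
    have hj : ((k - τ s : ℤ) : ZMod (2 * h)).val % 2 = 1 := by
      have := val_int_mod hh (k - τ s); omega
    have ht : t = τ s + ((k - τ s : ℤ) : ZMod (2 * h)) := by
      rw [← h3, ← hk]; push_cast; ring
    have hj1 := val_succ_mod hh ((k - τ s : ℤ) : ZMod (2 * h))
    have := hmem ((k - τ s : ℤ) : ZMod (2 * h)) x y hxy (by rw [hg1, if_neg (by omega), h1, ht])
      (by rw [hg1, if_pos (by omega), h2]) (by rw [hg2, h3, ht])
    rw [← this]
    exact ⟨ht, hj⟩

/-- The orientation induced by a cut path. -/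
lemma hit_orient (C : Cov G h τ lbl T E) {κ : Set (V × V)} (hκ : IsCutPath E κ) :
    IsOrient G (fun a b => ∃ t, Hit lbl T κ a b t) := by
  refine ⟨?_, ?_, ?_⟩
  · rintro a b ⟨t, x, y, hxy, rfl, rfl, -⟩
    exact ((C.edge _ _).mp (hκ.1 _ hxy)).1
  · intro a b hab
    obtain ⟨i, h1, h2, -⟩ := zigzag C hκ a (fun _ => b) (fun _ => hab)
    rcases Nat.mod_two_eq_zero_or_one i.val with hi | hi
    · exact Or.inl ⟨_, h1 hi⟩
    · exact Or.inr ⟨_, h2 hi⟩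
  · rintro a b ⟨⟨t, ht⟩, ⟨t', ht'⟩⟩
    have hab : G.Adj a b := by
      obtain ⟨x, y, hxy, rfl, rfl, -⟩ := ht
      exact ((C.edge _ _).mp (hκ.1 _ hxy)).1
    obtain ⟨i, -, -, h3, h4⟩ := zigzag C hκ a (fun _ => b) (fun _ => hab)
    have := (h3 t ht).2
    have := (h4 t' ht').2
    omega

lemma orient_eq (C : Cov G h τ lbl T E) {κ : Set (V × V)} (hκ : IsCutPath E κ)
    {o : B → B → Prop} (ho : IsOrient G o) :
    (∀ p ∈ κ, o (lbl p.1) (lbl p.2)) ↔ (fun a b => ∃ t, Hit lbl T κ a b t) = o := by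
  have hO := hit_orient C hκ
  constructor
  · intro hcomp
    have hsub : ∀ a b, (∃ t, Hit lbl T κ a b t) → o a b := by
      rintro a b ⟨t, x, y, hxy, rfl, rfl, -⟩
      exact hcomp _ hxy
    ext a b
    refine ⟨hsub a b, fun hab => ?_⟩
    rcases hO.2.1 a b (ho.1 a b hab) with h1 | h1
    · exact h1
    · exact (ho.2.2 a b ⟨hab, hsub b a h1⟩).elim
  · rintro rfl p hp
    exact ⟨_, p.1, p.2, hp, rfl, rfl, rfl⟩

lemma kap_surj (hG : G.Connected) (C : Cov G h τ lbl T E) {o : B → B → Prop} (ho : IsOrient G o)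
    (P : B → ℤ) (hP : ∀ a b, o a b → P b = P a - 1) (hnb : ∀ s, ∃ u, G.Adj s u) (r : B)
    {κ : Set (V × V)} (hκ : IsCutPath E κ) (hcomp : ∀ p ∈ κ, o (lbl p.1) (lbl p.2)) :
    ∃ x0, lbl x0 = r ∧ kap lbl T E o P x0 = κ := by
  classical
  have hho : ∀ {a b t}, Hit lbl T κ a b t → o a b := by
    rintro a b t ⟨x, y, hxy, rfl, rfl, -⟩
    exact hcomp _ hxy
  let D : B → B → ZMod (2 * h) → Prop := fun s u t => Hit lbl T κ s u t ∨ Hit lbl T κ u s (t + 1)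
  have hDex : ∀ s u, G.Adj s u → ∃ t, D s u t := by
    intro s u hsu
    obtain ⟨i, h1, h2, -⟩ := zigzag C hκ s (fun _ => u) (fun _ => hsu)
    rcases Nat.mod_two_eq_zero_or_one i.val with hi | hi
    · exact ⟨_, Or.inl (h1 hi)⟩
    · exact ⟨τ s + i - 1, Or.inr (by rw [sub_add_cancel]; exact h2 hi)⟩
  have hDuniq : ∀ s u v t t', G.Adj s u → G.Adj s v → D s u t → D s v t' → t = t' := by
    intro s u v t t' hu hv h1 h2
    by_contra hne
    obtain ⟨i, -, -, h3, h4⟩ := zigzag C hκ s (fun z => if z = t then u else v) (fun z => by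
      split_ifs <;> assumption)
    have k1 : (t = τ s + i ∧ i.val % 2 = 0) ∨ (t + 1 = τ s + i ∧ i.val % 2 = 1) := by
      rcases h1 with h1 | h1
      · exact Or.inl (h3 t (by simpa using h1))
      · exact Or.inr (h4 (t + 1) (by simpa using h1))
    have k2 : (t' = τ s + i ∧ i.val % 2 = 0) ∨ (t' + 1 = τ s + i ∧ i.val % 2 = 1) := by
      rcases h2 with h2 | h2
      · exact Or.inl (h3 t' (by simpa [Ne.symm hne] using h2))
      · exact Or.inr (h4 (t' + 1) (by simpa [Ne.symm hne] using h2))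
    rcases k1 with ⟨a1, a2⟩ | ⟨a1, a2⟩ <;> rcases k2 with ⟨b1, b2⟩ | ⟨b1, b2⟩
    · exact hne (a1.trans b1.symm)
    · omega
    · omega
    · exact hne (add_right_cancel (a1.trans b1.symm))
  have hσ : ∀ s, ∃ t, ∀ u, G.Adj s u → D s u t := by
    intro s
    obtain ⟨v, hv⟩ := hnb s
    obtain ⟨t, ht⟩ := hDex s v hv
    refine ⟨t, fun u hu => ?_⟩
    obtain ⟨t', ht'⟩ := hDex s u hu
    rwa [hDuniq s v u t t' hv hu ht ht']
  choose σ hσ using hσ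
  have hstep : ∀ s u, o s u → σ u = σ s - 1 := by
    intro s u hsu
    have hadj := ho.1 _ _ hsu
    have h1 := hσ s u hadj
    have h2 := hσ u s hadj.symm
    have k1 := h1.resolve_right (fun hh => ho.2.2 _ _ ⟨hsu, hho hh⟩)
    have k2 : D u s (σ s - 1) := Or.inr (by rw [sub_add_cancel]; exact k1)
    exact hDuniq u s s _ _ hadj.symm hadj.symm h2 k2
  have hconst : ∀ a b, σ a - ((P a : ℤ) : ZMod (2 * h)) = σ b - ((P b : ℤ) : ZMod (2 * h)) := by
    refine conn_const hG (fun a => σ a - ((P a : ℤ) : ZMod (2 * h))) ?_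
    intro a b hab
    rcases ho.2.1 a b hab with h1 | h1
    · simp only [hP _ _ h1, hstep _ _ h1]; push_cast; ring
    · simp only [hP _ _ h1, hstep _ _ h1]; push_cast; ring
  have hx0 : ∃ x0, lbl x0 = r ∧ T x0 = σ r := by
    obtain ⟨u, hu⟩ := hnb r
    rcases hσ r u hu with ⟨x, y, hxy, h1, h2, h3⟩ | ⟨x, y, hxy, h1, h2, h3⟩
    · exact ⟨x, h1, h3⟩
    · obtain ⟨k, hk⟩ := ZMod.intCast_surjective (T x)
      have hp := C.par x k hk.symm
      rw [h1] at hp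
      have := C.tau _ _ hu
      obtain ⟨x0, h4, h5⟩ := C.ex r (k - 1) (by omega)
      refine ⟨x0, h4, ?_⟩
      rw [h5]; push_cast; rw [hk, h3]; ring
  obtain ⟨x0, h0, h0'⟩ := hx0
  refine ⟨x0, h0, ?_⟩
  have hσe : ∀ s, T x0 + ((P s - P (lbl x0) : ℤ) : ZMod (2 * h)) = σ s := by
    intro s
    rw [h0', h0]
    have := hconst s r
    push_cast
    linear_combination (-1 : ZMod (2 * h)) * this
  ext ⟨x, y⟩
  simp only [kap, Set.mem_ofPred_eq, hσe]
  constructor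
  · rintro ⟨h1, h2, h3⟩
    have hadj := ho.1 _ _ h2
    obtain ⟨x', y', hxy, k1, k2, k3⟩ :=
      (hσ _ _ hadj).resolve_right (fun hh => ho.2.2 _ _ ⟨h2, hho hh⟩)
    have ex : x' = x := C.inj _ _ k1 (k3.trans h3.symm)
    have ey : y' = y := C.inj _ _ k2 (by
      rw [((C.edge _ _).mp h1).2, ((C.edge _ _).mp (hκ.1 _ hxy)).2, ← ex])
    rwa [← ex, ← ey]
  · intro hxy
    have hE := hκ.1 _ hxy
    refine ⟨hE, hcomp _ hxy, ?_⟩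
    have hadj := ((C.edge _ _).mp hE).1
    exact hDuniq _ _ _ _ _ hadj hadj (Or.inl ⟨x, y, hxy, rfl, rfl, rfl⟩) (hσ _ _ hadj)

lemma kap_inj (C : Cov G h τ lbl T E) {o : B → B → Prop} (ho : IsOrient G o)
    (P : B → ℤ) (hP : ∀ a b, o a b → P b = P a - 1) (r : B) (hnb : ∃ u, G.Adj r u)
    (x0 x1 : V) (h0 : lbl x0 = r) (h1 : lbl x1 = r)
    (heq : kap lbl T E o P x0 = kap lbl T E o P x1) : x0 = x1 := by
  refine C.inj _ _ (h0.trans h1.symm) ?_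
  obtain ⟨u, hu⟩ := hnb
  obtain ⟨k, hk⟩ := ZMod.intCast_surjective (T x0)
  have hp := C.par x0 k hk.symm
  rw [h0] at hp
  have htau := C.tau _ _ hu
  obtain ⟨y, hy1, hy2⟩ := C.ex u (k + 1) (by omega)
  obtain ⟨z, hz1, hz2⟩ := C.ex r (k + 2) (by omega)
  rcases ho.2.1 _ _ hu with h | h
  · have : (x0, y) ∈ kap lbl T E o P x0 := by
      refine ⟨(C.edge _ _).mpr ⟨by simpa [h0, hy1] using hu, ?_⟩, by simpa [h0, hy1] using h, by simp⟩
      simp only [hy2, ← hk]; push_cast; ring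
    rw [heq] at this
    have := this.2.2
    simpa [h0, h1] using this
  · have : (y, z) ∈ kap lbl T E o P x0 := by
      refine ⟨(C.edge _ _).mpr ⟨by simpa [hz1, hy1] using hu.symm, ?_⟩,
        by simpa [hz1, hy1] using h, ?_⟩
      · simp only [hy2, hz2]; push_cast; ring
      · have := hP _ _ h
        simp only [hy1, hy2, h0, this, ← hk]; push_cast; ring
    rw [heq] at this
    have h3 := this.2.2
    have := hP _ _ h
    simp only [hy1, hy2, h1, this] at h3
    push_cast at h3
    rw [hk] at h3
    linear_combination h3

lemma card_label (C : Cov G h τ lbl T E) (r : B) : Nat.card {x : V // lbl x = r} = h := by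
  have hh := C.hpos
  have hv : ∀ k : Fin h, ∃ x, lbl x = r ∧ T x = ((τ r + 2 * (k : ℕ) : ℤ) : ZMod (2 * h)) :=
    fun k => C.ex r _ (by omega)
  choose v hv1 hv2 using hv
  have hb : Function.Bijective (fun k : Fin h => (⟨v k, hv1 k⟩ : {x : V // lbl x = r})) := by
    constructor
    · intro k k' hkk
      have e : v k = v k' := congrArg Subtype.val hkk
      have e2 := hv2 k
      rw [e, hv2 k', ZMod.intCast_eq_intCast_iff_dvd_sub] at e2
      have e3 : ((2 * h : ℕ) : ℤ) ∣ 2 * ((k : ℕ) - (k' : ℕ) : ℤ) := by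
        convert e2 using 1; ring
      push_cast at e3
      rw [mul_dvd_mul_iff_left (by norm_num)] at e3
      have e4 := Int.eq_zero_of_abs_lt_dvd e3 (by rw [abs_lt]; omega)
      exact Fin.ext (by omega)
    · rintro ⟨x, hx⟩
      obtain ⟨k, hk⟩ := ZMod.intCast_surjective (T x)
      have hp := C.par x k hk.symm
      rw [hx] at hp
      have hn := Int.emod_nonneg ((k - τ r) / 2) (show (h : ℤ) ≠ 0 by omega)
      have hl := Int.emod_lt_of_pos ((k - τ r) / 2) (show (0 : ℤ) < h by omega)
      refine ⟨⟨(((k - τ r) / 2) % h).toNat, by omega⟩, ?_⟩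
      apply Subtype.ext
      refine C.inj _ _ ((hv1 _).trans hx.symm) ?_
      rw [hv2, ← hk, ZMod.intCast_eq_intCast_iff_dvd_sub]
      simp only [Int.toNat_of_nonneg hn]
      have e := Int.dvd_self_sub_emod (x := (k - τ r) / 2) (m := h)
      have e2 : k - (τ r + 2 * ((k - τ r) / 2 % h)) = 2 * ((k - τ r) / 2 - (k - τ r) / 2 % h) := by
        omega
      rw [e2]
      push_cast
      exact mul_dvd_mul_left 2 e
  rw [← Nat.card_congr (Equiv.ofBijective _ hb)]
  simp

lemma card_fiber [Fintype B] (hG : G.IsTree)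
    (hsp : ∀ z a a' b b' c c' : B, [z, a, a', b, b', c, c'].Nodup → G.Adj z a → G.Adj a a' →
      G.Adj z b → G.Adj b b' → G.Adj z c → G.Adj c c' → False)
    (C : Cov G h τ lbl T E) (hnb : ∀ s, ∃ u, G.Adj s u) {o : B → B → Prop} (ho : IsOrient G o) :
    Nat.card {κ : Set (V × V) // IsCutPath E κ ∧ ∀ p ∈ κ, o (lbl p.1) (lbl p.2)} = h := by
  obtain ⟨r⟩ := hG.connected.nonempty
  obtain ⟨P, hP⟩ := orient_potential hG ho
  rw [← card_label C r]
  symm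
  refine Nat.card_congr (Equiv.ofBijective
    (fun x => ⟨kap lbl T E o P x.1, kap_cut hG hsp C ho P hP x.1, fun p hp => hp.2.1⟩) ⟨?_, ?_⟩)
  · rintro ⟨x, hx⟩ ⟨y, hy⟩ hxy
    exact Subtype.ext (kap_inj C ho P hP r (hnb r) x y hx hy (congrArg Subtype.val hxy))
  · rintro ⟨κ, hκ1, hκ2⟩
    obtain ⟨x0, h1, h2⟩ := kap_surj hG.connected C ho P hP hnb r hκ1 hκ2
    exact ⟨⟨x0, h1⟩, Subtype.ext h2⟩

lemma card_orient [Fintype B] (hG : G.IsTree) :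
    Nat.card {o : B → B → Prop // IsOrient G o} = 2 ^ (Fintype.card B - 1) := by
  classical
  let ix : B → ℕ := fun b => (Fintype.equivFin B b : ℕ)
  have hix : ∀ a b, ix a = ix b → a = b := fun a b hab =>
    (Fintype.equivFin B).injective (Fin.ext hab)
  have hb : Function.Bijective (fun (o : {o : B → B → Prop // IsOrient G o}) =>
      ({e : G.edgeSet | ∃ a b, e.1 = s(a, b) ∧ ix a < ix b ∧ o.1 a b} : Set G.edgeSet)) := by
    constructor
    · rintro ⟨o, ho⟩ ⟨o', ho'⟩ hoo
      have key : ∀ o, IsOrient G o → ∀ a b (hab : G.Adj a b), ix a < ix b →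
          (o a b ↔ (⟨s(a, b), hab⟩ : G.edgeSet) ∈ {e : G.edgeSet | ∃ a b, e.1 = s(a, b) ∧ ix a < ix b ∧ o a b}) := by
        intro o ho a b hab hlt
        simp only [Set.mem_ofPred_eq]
        constructor
        · intro hh; exact ⟨a, b, rfl, hlt, hh⟩
        · rintro ⟨a', b', he, hlt', hh⟩
          rcases Sym2.eq_iff.mp he with ⟨rfl, rfl⟩ | ⟨rfl, rfl⟩
          · exact hh
          · omega
      have key2 : ∀ a b, G.Adj a b → ix a < ix b → (o a b ↔ o' a b) := by
        intro a b hab hlt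
        rw [key o ho a b hab hlt, key o' ho' a b hab hlt]
        have := Set.ext_iff.mp hoo ⟨s(a, b), hab⟩
        exact this
      apply Subtype.ext
      have hflip : ∀ o, IsOrient G o → ∀ a b, G.Adj a b → (o a b ↔ ¬ o b a) := by
        intro o ho a b hab
        have h1 := ho.2.1 a b hab
        have h2 := ho.2.2 a b
        tauto
      have main : ∀ a b, G.Adj a b → (o a b ↔ o' a b) := by
        intro a b hab
        rcases Nat.lt_trichotomy (ix a) (ix b) with hl | hl | hl
        · exact key2 a b hab hl
        · exact absurd (hix _ _ hl) hab.ne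
        · rw [hflip o ho a b hab, hflip o' ho' a b hab, key2 b a hab.symm hl]
      ext a b
      constructor
      · intro hh; exact (main a b (ho.1 _ _ hh)).mp hh
      · intro hh; exact (main a b (ho'.1 _ _ hh)).mpr hh
    · intro F
      let o : B → B → Prop := fun a b => ∃ hab : G.Adj a b,
        if ix a < ix b then (⟨s(a, b), hab⟩ : G.edgeSet) ∈ F else (⟨s(a, b), hab⟩ : G.edgeSet) ∉ F
      have hsw : ∀ a b (hab : G.Adj a b), (⟨s(b, a), hab.symm⟩ : G.edgeSet) = ⟨s(a, b), hab⟩ :=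
        fun a b hab => Subtype.ext Sym2.eq_swap
      have ho : IsOrient G o := by
        refine ⟨fun a b hh => hh.1, ?_, ?_⟩
        · intro a b hab
          have hne : ix a ≠ ix b := fun hh => hab.ne (hix _ _ hh)
          by_cases hF : (⟨s(a, b), hab⟩ : G.edgeSet) ∈ F <;> by_cases hl : ix a < ix b
          · exact Or.inl ⟨hab, by rw [if_pos hl]; exact hF⟩
          · exact Or.inr ⟨hab.symm, by rw [if_pos (by omega), hsw a b hab]; exact hF⟩
          · exact Or.inr ⟨hab.symm, by rw [if_neg (by omega), hsw a b hab]; exact hF⟩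
          · exact Or.inl ⟨hab, by rw [if_neg hl]; exact hF⟩
        · rintro a b ⟨⟨hab, h1⟩, ⟨hba, h2⟩⟩
          have hne : ix a ≠ ix b := fun hh => hab.ne (hix _ _ hh)
          rw [hsw a b hab] at h2
          by_cases hl : ix a < ix b
          · rw [if_pos hl] at h1; rw [if_neg (by omega)] at h2; exact h2 h1
          · rw [if_neg hl] at h1; rw [if_pos (by omega)] at h2; exact h1 h2
      refine ⟨⟨o, ho⟩, ?_⟩
      ext ⟨e, he⟩
      simp only [Set.mem_ofPred_eq]
      constructor
      · rintro ⟨a, b, rfl, hl, hab, hh⟩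
        rw [if_pos hl] at hh
        exact hh
      · intro hF
        induction e with
        | _ a b =>
          have hab : G.Adj a b := he
          have hne : ix a ≠ ix b := fun hh => hab.ne (hix _ _ hh)
          by_cases hl : ix a < ix b
          · exact ⟨a, b, rfl, hl, hab, by rw [if_pos hl]; exact hF⟩
          · refine ⟨b, a, Sym2.eq_swap, by omega, hab.symm, ?_⟩
            rw [if_pos (by omega), hsw a b hab]; exact hF
  rw [Nat.card_congr (Equiv.ofBijective _ hb)]
  have hc := hG.card_edgeFinset
  rw [Nat.card_eq_fintype_card, Fintype.card_set, ← hc, SimpleGraph.edgeFinset_card]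
  simp

lemma card_all [Fintype B] (hG : G.IsTree)
    (hsp : ∀ z a a' b b' c c' : B, [z, a, a', b, b', c, c'].Nodup → G.Adj z a → G.Adj a a' →
      G.Adj z b → G.Adj b b' → G.Adj z c → G.Adj c c' → False)
    (C : Cov G h τ lbl T E) (hnb : ∀ s, ∃ u, G.Adj s u) :
    Nat.card {κ : Set (V × V) // IsCutPath E κ} = 2 ^ (Fintype.card B - 1) * h := by
  classical
  let φ : {κ : Set (V × V) // IsCutPath E κ} → {o : B → B → Prop // IsOrient G o} :=
    fun κ => ⟨fun a b => ∃ t, Hit lbl T κ.1 a b t, hit_orient C κ.2⟩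
  have hfib : ∀ o, Nat.card {κ // φ κ = o} = h := by
    rintro ⟨o, ho⟩
    rw [← card_fiber hG hsp C hnb ho]
    refine Nat.card_congr
      { toFun := fun κ => ⟨κ.1.1, κ.1.2, (orient_eq C κ.1.2 ho).mpr (congrArg Subtype.val κ.2)⟩
        invFun := fun κ => ⟨⟨κ.1, κ.2.1⟩, Subtype.ext ((orient_eq C κ.2.1 ho).mp κ.2.2)⟩
        left_inv := fun _ => rfl
        right_inv := fun _ => rfl }
  have hfin : ∀ o, Finite {κ // φ κ = o} := fun o =>
    Nat.finite_of_card_ne_zero (by rw [hfib]; exact C.hpos.ne')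
  have : Fintype {o : B → B → Prop // IsOrient G o} := Fintype.ofFinite _
  rw [← Nat.card_congr (Equiv.sigmaFiberEquiv φ), Nat.card_sigma]
  simp only [hfib, Finset.sum_const, Finset.card_univ, smul_eq_mul]
  rw [← Nat.card_eq_fintype_card, card_orient hG]

end cover

section conc
variable {B : Type*}

lemma letter_iff [Nonempty B] [DecidableEq B] {cw : List B} (hcw : IsCoxWord cw) (j : ℕ) (s : B) :
    letterAt cw j = s ↔ j % cw.length = cw.idxOf s := by
  have hpos : 0 < cw.length := List.length_pos_of_mem (hcw.2 s)
  have hj := Nat.mod_lt j hpos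
  unfold letterAt
  rw [List.getD_eq_getElem _ _ hj]
  constructor
  · rintro rfl
    exact (hcw.1.idxOf_getElem _ hj).symm
  · intro hh
    simp only [hh]
    exact List.getElem_idxOf _

lemma letter_eq_iff [Nonempty B] {cw : List B} (hcw : IsCoxWord cw) (i j : ℕ) :
    letterAt cw i = letterAt cw j ↔ i % cw.length = j % cw.length := by
  classical
  rw [letter_iff hcw, ← (letter_iff hcw j _).mp rfl]

lemma mod_window {n a b : ℕ} (h1 : a < b) (h2 : b < a + n) (h3 : a % n = b % n) : False := by
  have h4 := (Nat.modEq_iff_dvd' h1.le).mp h3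
  have := Nat.le_of_dvd (by omega) h4
  omega

lemma mod_far {n a b : ℕ} (h1 : a < b) (h3 : a % n = b % n) : a + n ≤ b := by
  by_contra h
  exact mod_window h1 (by omega) h3

lemma next_occ [Nonempty B] {cw : List B} (hcw : IsCoxWord cw) (a : ℕ) (s : B)
    (hs : letterAt cw a ≠ s) : ∃ c, a < c ∧ c < a + cw.length ∧ letterAt cw c = s := by
  classical
  have hi : cw.idxOf s < cw.length := List.idxOf_lt_length_of_mem (hcw.2 s)
  have hpos : 0 < cw.length := by omega
  rw [Ne, letter_iff hcw] at hs
  have hr := Nat.mod_lt a hpos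
  have hd := Nat.div_add_mod a cw.length
  rcases Nat.lt_or_ge (a % cw.length) (cw.idxOf s) with hl | hl
  · refine ⟨cw.length * (a / cw.length) + cw.idxOf s, by omega, by omega, ?_⟩
    rw [letter_iff hcw, Nat.mul_add_mod, Nat.mod_eq_of_lt hi]
  · refine ⟨cw.length * (a / cw.length + 1) + cw.idxOf s, ?_, ?_, ?_⟩
    · rw [mul_add, mul_one]; omega
    · rw [mul_add, mul_one]; omega
    · rw [letter_iff hcw, Nat.mul_add_mod, Nat.mod_eq_of_lt hi]

lemma npo_lt [Nonempty B] {M : CoxeterMatrix B} {cw : List B} {a b : ℕ} (h : npoInf M cw a b) :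
    a < b := by
  unfold npoInf at h
  induction h with
  | single h => exact h.1
  | tail _ h ih => exact ih.trans h.1

lemma npo_const [Nonempty B] {M : CoxeterMatrix B} {cw : List B}
    (hM : ∀ a b, M a b ≠ 2 ↔ a = b ∨ (coxGraph M).Adj a b) (g : B → ℤ) (s : B)
    (hg : ∀ u v, (coxGraph M).Adj u v → u ≠ s → v ≠ s → g u = g v) {a b : ℕ}
    (h : npoInf M cw a b) :
    (∀ z, a ≤ z → z ≤ b → letterAt cw z ≠ s) → g (letterAt cw a) = g (letterAt cw b) := by
  have step : ∀ a b : ℕ, a < b → M (letterAt cw a) (letterAt cw b) ≠ 2 →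
      (∀ z, a ≤ z → z ≤ b → letterAt cw z ≠ s) → g (letterAt cw a) = g (letterAt cw b) := by
    intro a b hab h2 hz
    rcases (hM _ _).mp h2 with h3 | h3
    · rw [h3]
    · exact hg _ _ h3 (hz a le_rfl hab.le) (hz b hab.le le_rfl)
  unfold npoInf at h
  induction h with
  | single h => exact step _ _ h.1 h.2
  | @tail b c hab h ih =>
    intro hz
    have h0 : a < b := npo_lt (M := M) (cw := cw) hab
    exact (ih (fun z h1 h2 => hz z h1 (h2.trans h.1.le))).trans
      (step _ _ h.1 h.2 (fun z h1 h2 => hz z (by omega) h2))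

lemma hasse_iff [Nonempty B] {M : CoxeterMatrix B} {cw : List B} (hcw : IsCoxWord cw)
    (hG : (coxGraph M).IsTree)
    (hM : ∀ a b, M a b ≠ 2 ↔ a = b ∨ (coxGraph M).Adj a b) (hnb : ∀ s, ∃ u, (coxGraph M).Adj s u)
    (a b : ℕ) : hasseInf M cw a b ↔
      a < b ∧ b < a + cw.length ∧ (coxGraph M).Adj (letterAt cw a) (letterAt cw b) := by
  have hper : ∀ j, letterAt cw (j + cw.length) = letterAt cw j := by
    intro j; rw [letter_eq_iff hcw]; simp
  have hpos : 0 < cw.length := List.length_pos_of_mem (hcw.2 (Classical.arbitrary B))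
  have sing : ∀ a b, a < b → (letterAt cw a = letterAt cw b ∨
      (coxGraph M).Adj (letterAt cw a) (letterAt cw b)) → npoInf M cw a b :=
    fun a b h1 h2 => Relation.TransGen.single ⟨h1, (hM _ _).mpr h2⟩
  constructor
  · rintro ⟨h1, h2⟩
    have h3 : a < b ∧ M (letterAt cw a) (letterAt cw b) ≠ 2 := by
      unfold npoInf at h1
      cases h1 with
      | single h => exact h
      | tail h h' => exact (h2 ⟨_, h, Relation.TransGen.single h'⟩).elim
    obtain ⟨hab, h3⟩ := h3
    rcases (hM _ _).mp h3 with h4 | h4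
    · exfalso
      obtain ⟨u, hu⟩ := hnb (letterAt cw a)
      obtain ⟨c, hc1, hc2, hc3⟩ := next_occ hcw a u hu.ne
      have := mod_far hab ((letter_eq_iff hcw _ _).mp h4)
      exact h2 ⟨c, sing _ _ hc1 (Or.inr (by rw [hc3]; exact hu)),
        sing _ _ (by omega) (Or.inr (by rw [hc3, ← h4]; exact hu.symm))⟩
    · refine ⟨hab, ?_, h4⟩
      by_contra hb
      have hne : b ≠ a + cw.length := by
        rintro rfl
        rw [hper] at h4
        exact h4.ne rfl
      exact h2 ⟨a + cw.length, sing _ _ (by omega) (Or.inl (hper a).symm),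
        sing _ _ (by omega) (Or.inr (by rw [hper]; exact h4))⟩
  · rintro ⟨hab, hb, hadj⟩
    refine ⟨sing _ _ hab (Or.inr hadj), ?_⟩
    rintro ⟨c, h1, h2⟩
    have l1 := npo_lt h1
    have l2 := npo_lt h2
    obtain ⟨g, hg1, hg2⟩ := tree_bridge hG hadj
    apply hg1
    have e1 := npo_const hM g (letterAt cw b) (fun u v huv h3 h4 =>
      hg2 u v huv (fun h => h4 h.2) (fun h => h3 h.1)) h1 (fun z hz1 hz2 he =>
        mod_window (a := z) (b := b) (n := cw.length) (by omega) (by omega) ((letter_eq_iff hcw _ _).mp he))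
    have e2 := npo_const hM g (letterAt cw a) (fun u v huv h3 h4 =>
      hg2 u v huv (fun h => h3 h.1) (fun h => h4 h.2)) h2 (fun z hz1 hz2 he =>
        mod_window (a := a) (b := z) (n := cw.length) (by omega) (by omega)
          ((letter_eq_iff hcw _ _).mp he.symm))
    exact e1.trans e2

lemma cover_cov [Nonempty B] {M : CoxeterMatrix B} {cw : List B} (hcw : IsCoxWord cw)
    (hG : (coxGraph M).IsTree)
    (hM : ∀ a b, M a b ≠ 2 ↔ a = b ∨ (coxGraph M).Adj a b) (hnb : ∀ s, ∃ u, (coxGraph M).Adj s u)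
    (h : ℕ) (hh : 0 < h) :
    ∃ (τ : B → ℤ) (T : ZMod (cw.length * h) → ZMod (2 * h)),
      Cov (coxGraph M) h τ (fun x : ZMod (cw.length * h) => coverLabel cw x) T
        (coverEdge M cw (cw.length * h)) := by
  classical
  have hpos : 0 < cw.length := List.length_pos_of_mem (hcw.2 (Classical.arbitrary B))
  have hN : NeZero (cw.length * h) := ⟨(Nat.mul_pos hpos hh).ne'⟩
  obtain ⟨τ, hτ⟩ := tree_potential hG (fun a b => if cw.idxOf a < cw.idxOf b then 1 else -1) (by
    intro a b hab
    have : cw.idxOf a ≠ cw.idxOf b := fun he => hab.ne ((List.idxOf_inj (hcw.2 a)).mp he)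
    split_ifs <;> omega)
  let n := cw.length
  let T' : ℕ → ℤ := fun a => 2 * ((a / n : ℕ) : ℤ) + τ (letterAt cw a)
  let T : ZMod (n * h) → ZMod (2 * h) := fun x => ((T' x.val : ℤ) : ZMod (2 * h))
  have hl : ∀ a : ℕ, coverLabel cw (a : ZMod (n * h)) = letterAt cw a := by
    intro a
    unfold coverLabel
    rw [letter_eq_iff hcw, ZMod.val_natCast]
    exact Nat.mod_mul_right_mod _ _ _
  have hT : ∀ a : ℕ, T (a : ZMod (n * h)) = ((T' a : ℤ) : ZMod (2 * h)) := by
    intro a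
    simp only [T]
    have h1 := hl a
    unfold coverLabel at h1
    simp only [T', h1]
    rw [ZMod.val_natCast, Nat.mod_mul_right_div_self, ZMod.intCast_eq_intCast_iff_dvd_sub]
    have e := Int.dvd_self_sub_emod (x := ((a / n : ℕ) : ℤ)) (m := h)
    have e2 : 2 * ((a / n : ℕ) : ℤ) + τ (letterAt cw a) -
        (2 * ((a / n % h : ℕ) : ℤ) + τ (letterAt cw a)) =
        2 * (((a / n : ℕ) : ℤ) - ((a / n : ℕ) : ℤ) % h) := by push_cast; ring
    rw [e2]; push_cast
    exact mul_dvd_mul_left 2 (by exact_mod_cast e)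
  have hstep : ∀ a b, a < b → b < a + n → (coxGraph M).Adj (letterAt cw a) (letterAt cw b) →
      T' b = T' a + 1 := by
    intro a b h1 h2 h3
    have e := hτ _ _ h3
    rw [← (letter_iff hcw a _).mp rfl, ← (letter_iff hcw b _).mp rfl] at e
    have q1 : a / n ≤ b / n := Nat.div_le_div_right h1.le
    have q2 : b / n ≤ a / n + 1 := by
      rw [← Nat.add_div_right a hpos]; exact Nat.div_le_div_right h2.le
    have d1 := Nat.div_add_mod a n
    have d2 := Nat.div_add_mod b n
    simp only [T']
    rcases (show b / n = a / n ∨ b / n = a / n + 1 by omega) with q | q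
    · rw [q] at d2
      rw [if_pos (show a % n < b % n by omega)] at e
      rw [q, e]; ring
    · rw [q, mul_add, mul_one] at d2
      rw [if_neg (show ¬ a % n < b % n by omega)] at e
      rw [q, e]; push_cast; ring
  have hinj : ∀ x y : ZMod (n * h), coverLabel cw x = coverLabel cw y → T x = T y → x = y := by
    intro x y h1 h2
    unfold coverLabel at h1
    simp only [T, T', h1] at h2
    rw [letter_eq_iff hcw] at h1
    rw [ZMod.intCast_eq_intCast_iff_dvd_sub] at h2
    have e : 2 * ((y.val / n : ℕ) : ℤ) + τ (letterAt cw y.val) -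
        (2 * ((x.val / n : ℕ) : ℤ) + τ (letterAt cw y.val)) =
        2 * (((y.val / n : ℕ) : ℤ) - ((x.val / n : ℕ) : ℤ)) := by ring
    rw [e] at h2
    push_cast at h2
    rw [mul_dvd_mul_iff_left (by norm_num)] at h2
    have hx : x.val / n < h := Nat.div_lt_of_lt_mul (ZMod.val_lt x)
    have hy : y.val / n < h := Nat.div_lt_of_lt_mul (ZMod.val_lt y)
    have e4 := Int.eq_zero_of_abs_lt_dvd h2 (by
      rw [abs_lt]; push_cast at hx hy ⊢; constructor <;> (zify at hx hy; push_cast at hx hy; have := Int.natCast_nonneg (x.val / n); have := Int.natCast_nonneg (y.val / n); push_cast at *; omega))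
    have e5 : x.val / n = y.val / n := by
      have : (((y.val / n : ℕ) : ℤ) - ((x.val / n : ℕ) : ℤ)) = 0 := by exact_mod_cast e4
      omega
    apply ZMod.val_injective
    rw [← Nat.div_add_mod x.val n, ← Nat.div_add_mod y.val n, e5]
    exact congrArg _ h1
  refine ⟨τ, T, ⟨hh, hinj, ?_, ?_, ?_, ?_⟩⟩
  · intro s k hk
    have hi : cw.idxOf s < n := List.idxOf_lt_length_of_mem (hcw.2 s)
    have hn := Int.emod_nonneg ((k - τ s) / 2) (show (h : ℤ) ≠ 0 by omega)
    have hlab : letterAt cw (n * (((k - τ s) / 2) % h).toNat + cw.idxOf s) = s := by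
      rw [letter_iff hcw]
      rw [Nat.mul_add_mod, Nat.mod_eq_of_lt hi]
    refine ⟨((n * (((k - τ s) / 2) % h).toNat + cw.idxOf s : ℕ) : ZMod (n * h)), ?_, ?_⟩
    · exact (hl _).trans hlab
    · rw [hT]
      simp only [T', hlab]
      rw [Nat.mul_add_div hpos, Nat.div_eq_of_lt hi, add_zero, Int.toNat_of_nonneg hn,
        ZMod.intCast_eq_intCast_iff_dvd_sub]
      have e := Int.dvd_self_sub_emod (x := (k - τ s) / 2) (m := h)
      have e2 : k - (2 * ((k - τ s) / 2 % h) + τ s) = 2 * ((k - τ s) / 2 - (k - τ s) / 2 % h) := by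
        omega
      rw [e2]
      push_cast
      exact mul_dvd_mul_left 2 e
  · intro x k hk
    simp only [T, T'] at hk
    rw [ZMod.intCast_eq_intCast_iff_dvd_sub] at hk
    have h2 : (2 : ℤ) ∣ k - (2 * ((x.val / n : ℕ) : ℤ) + τ (letterAt cw x.val)) :=
      dvd_trans (by push_cast; exact Dvd.intro _ rfl) hk
    unfold coverLabel
    omega
  · intro x y
    constructor
    · rintro ⟨a, b, hab, rfl, rfl⟩
      obtain ⟨h1, h2, h3⟩ := (hasse_iff hcw hG hM hnb a b).mp hab
      refine ⟨?_, ?_⟩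
      · rw [hl, hl]; exact h3
      · rw [hT, hT, hstep a b h1 h2 h3]; push_cast; rfl
    · rintro ⟨h1, h2⟩
      obtain ⟨b, hb1, hb2, hb3⟩ := next_occ hcw x.val (coverLabel cw y) h1.ne
      have hadj : (coxGraph M).Adj (letterAt cw x.val) (letterAt cw b) := by rw [hb3]; exact h1
      refine ⟨x.val, b, (hasse_iff hcw hG hM hnb _ _).mpr ⟨hb1, hb2, hadj⟩,
        ZMod.natCast_zmod_val x, ?_⟩
      refine hinj _ _ ((hl b).trans hb3) ?_
      rw [hT, hstep _ _ hb1 hb2 hadj, h2]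
      push_cast; rfl
  · intro a b hab
    have := hτ a b hab
    split_ifs at this <;> omega

lemma cut_one {N : ℕ} (hN : 0 < N) (E : ZMod N → ZMod N → Prop) (hE : ∀ x y, E x y ↔ y = x + 1) :
    Nat.card {κ : Set (ZMod N × ZMod N) // IsCutPath E κ} = N := by
  have : NeZero N := ⟨hN.ne'⟩
  have hcut : ∀ x : ZMod N, IsCutPath E {(x, x + 1)} := by
    intro x
    refine ⟨?_, ?_⟩
    · rintro p rfl
      exact (hE _ _).mpr rfl
    · intro m hm f hf hfE
      have : NeZero m := ⟨hm.ne'⟩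
      have hf1 : ∀ i, f (i + 1) = f i + 1 := fun i => (hE _ _).mp (hfE i)
      have hfk : ∀ k : ℕ, f (k : ZMod m) = f 0 + k := by
        intro k
        induction k with
        | zero => simp
        | succ k ih => push_cast; rw [hf1, ih]; ring
      have hs : ∃ i, f i = x := by
        refine ⟨((x - f 0).val : ZMod m), ?_⟩
        rw [hfk, ZMod.natCast_zmod_val]; ring
      obtain ⟨i, hi⟩ := hs
      refine ⟨i, ?_, ?_⟩
      · simp only [Set.mem_singleton_iff, hf1, hi]
      · intro j hj
        simp only [Set.mem_singleton_iff, Prod.mk.injEq] at hj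
        exact hf (hj.1.trans hi.symm)
  have hb : Function.Bijective (fun x : ZMod N =>
      (⟨{(x, x + 1)}, hcut x⟩ : {κ : Set (ZMod N × ZMod N) // IsCutPath E κ})) := by
    constructor
    · intro x y hxy
      have := congrArg Subtype.val hxy
      simp only [Set.singleton_eq_singleton_iff, Prod.mk.injEq] at this
      exact this.1
    · rintro ⟨κ, hκ1, hκ2⟩
      obtain ⟨i, hi, hi2⟩ := hκ2 N hN id Function.injective_id (fun i => (hE _ _).mpr rfl)
      refine ⟨i, Subtype.ext ?_⟩
      ext ⟨x, y⟩
      simp only [Set.mem_singleton_iff, Prod.mk.injEq]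
      constructor
      · rintro ⟨rfl, rfl⟩; exact hi
      · intro hxy
        have e := (hE _ _).mp (hκ1 _ hxy)
        simp only at e
        subst e
        have := hi2 x hxy
        exact ⟨this, by rw [this]⟩
  rw [← Nat.card_congr (Equiv.ofBijective _ hb)]
  simp

lemma hasse_one [Nonempty B] [Subsingleton B] {M : CoxeterMatrix B} {cw : List B}
    (a b : ℕ) : hasseInf M cw a b ↔ b = a + 1 := by
  have hM : ∀ s t : B, M s t ≠ 2 := by
    intro s t
    rw [Subsingleton.elim s t, M.diagonal]; norm_num
  have sing : ∀ a b, a < b → npoInf M cw a b :=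
    fun a b h1 => Relation.TransGen.single ⟨h1, hM _ _⟩
  constructor
  · rintro ⟨h1, h2⟩
    have := npo_lt h1
    by_contra hne
    exact h2 ⟨a + 1, sing _ _ (by omega), sing _ _ (by omega)⟩
  · rintro rfl
    refine ⟨sing _ _ (by omega), ?_⟩
    rintro ⟨c, h1, h2⟩
    have := npo_lt h1
    have := npo_lt h2
    omega

lemma edge_one [Nonempty B] [Subsingleton B] {M : CoxeterMatrix B} {cw : List B} {N : ℕ}
    (hN : 0 < N) (x y : ZMod N) : coverEdge M cw N x y ↔ y = x + 1 := by
  have : NeZero N := ⟨hN.ne'⟩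
  constructor
  · rintro ⟨a, b, hab, rfl, rfl⟩
    rw [(hasse_one a b).mp hab]; push_cast; rfl
  · rintro rfl
    exact ⟨x.val, x.val + 1, (hasse_one _ _).mpr rfl, by simp, by simp⟩

end conc

/-- For an irreducible finite Coxeter system of rank `n` with Coxeter number `h`, the total
number of cut paths of the `2`-cover is `2^{n−1}·h`; moreover the map `Φ` sending a cut
path to its induced Coxeter element (orientation of the Coxeter graph) is surjective with
every fiber of cardinality exactly `h`. -/
theorem card_cutPaths {B W : Type*} [Group W] [Fintype B] [Nonempty B] [Finite W]
    (M : CoxeterMatrix B) (cs : CoxeterSystem M W) (hirr : (coxGraph M).Connected)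
    (cw : List B) (hcw : IsCoxWord cw) :
    (Nat.card {κ : Set (ZMod (cw.length * orderOf (cs.wordProd cw)) ×
          ZMod (cw.length * orderOf (cs.wordProd cw))) //
        IsCutPath (coverEdge M cw (cw.length * orderOf (cs.wordProd cw))) κ} =
      2 ^ (Fintype.card B - 1) * orderOf (cs.wordProd cw)) ∧
    ∀ o : B → B → Prop, (∀ a b : B, o a b → 3 ≤ M a b) →
      (∀ a b : B, 3 ≤ M a b → (o a b ∨ o b a)) → (∀ a b : B, ¬ (o a b ∧ o b a)) →
      Nat.card {κ : Set (ZMod (cw.length * orderOf (cs.wordProd cw)) ×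
          ZMod (cw.length * orderOf (cs.wordProd cw))) //
        IsCutPath (coverEdge M cw (cw.length * orderOf (cs.wordProd cw))) κ ∧
          ∀ p ∈ κ, 3 ≤ M (coverLabel cw p.1) (coverLabel cw p.2) →
            o (coverLabel cw p.1) (coverLabel cw p.2)} =
        orderOf (cs.wordProd cw) := by
  have hh : 0 < orderOf (cs.wordProd cw) := orderOf_pos _
  have hlen : cw.length = Fintype.card B := by
    classical
    rw [← List.toFinset_card_of_nodup hcw.1]
    have : cw.toFinset = Finset.univ := by
      ext b; simp [hcw.2 b]
    rw [this, Finset.card_univ]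
  have hpos : 0 < cw.length := by rw [hlen]; exact Fintype.card_pos
  have hG := cox_isTree M cs hirr
  generalize orderOf (cs.wordProd cw) = h at hh ⊢
  rcases subsingleton_or_nontrivial B with hB | hB
  · have hc : Fintype.card B = 1 :=
      le_antisymm (Fintype.card_le_one_iff_subsingleton.mpr hB) Fintype.card_pos
    have hN : 0 < cw.length * h := Nat.mul_pos hpos hh
    have hk := cut_one hN (coverEdge M cw (cw.length * h)) (edge_one hN)
    have hN' : cw.length * h = h := by rw [hlen, hc, one_mul]
    refine ⟨?_, ?_⟩
    · rw [hk, hN', hc]; simp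
    · intro o _ _ _
      have e : ∀ κ : Set (ZMod (cw.length * h) × ZMod (cw.length * h)),
          (IsCutPath (coverEdge M cw (cw.length * h)) κ ∧
          ∀ p ∈ κ, 3 ≤ M (coverLabel cw p.1) (coverLabel cw p.2) →
            o (coverLabel cw p.1) (coverLabel cw p.2)) ↔
          IsCutPath (coverEdge M cw (cw.length * h)) κ := by
        intro κ
        refine and_iff_left (fun p _ h3 => ?_)
        rw [Subsingleton.elim (coverLabel cw p.1) (coverLabel cw p.2), M.diagonal] at h3
        omega
      rw [Nat.card_congr (Equiv.subtypeEquivRight e), hk, hN']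
  · have hnb : ∀ s, ∃ u, (coxGraph M).Adj s u := fun s =>
      hirr.preconnected.exists_adj_of_nontrivial s
    obtain ⟨τ, T, C⟩ := cover_cov hcw hG (M_ne_two M cs hirr) hnb h hh
    have hsp := cox_no_spider M cs hirr
    refine ⟨card_all hG hsp C hnb, ?_⟩
    intro o h1 h2 h3
    have ho : IsOrient (coxGraph M) o :=
      ⟨fun a b hab => (coxGraph_adj M a b).mpr (h1 a b hab),
        fun a b hab => h2 a b ((coxGraph_adj M a b).mp hab), h3⟩
    refine Eq.trans ?_ (card_fiber hG hsp C hnb ho)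
    refine Nat.card_congr (Equiv.subtypeEquivRight (fun κ => ?_))
    refine and_congr_right (fun hκ => ?_)
    refine forall₂_congr (fun p hp => ?_)
    have hadj := ((C.edge _ _).mp (hκ.1 p hp)).1
    exact ⟨fun hx => hx ((coxGraph_adj M _ _).mp hadj), fun hx _ => hx⟩

end Cambrian
end

section
/- For the linear (Loday) Coxeter element c_Lod of the symmetric group Σ_{n+1} (type A_n), the number of c-singletons is S_{c_Lod} = 2^n. -/
open CoxeterSystem

namespace Cambrian

variable {B : Type*} {W : Type*} [Group W]

variable {M : CoxeterMatrix B}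

/-! ### Injectivity of the permutation representation -/

/-- Descending product `s (k+t-1) * ... * s k`. -/
def descProd {G : Type*} [Group G] (s : ℕ → G) (k : ℕ) : ℕ → G
  | 0 => 1
  | t + 1 => s (k + t) * descProd s k t

theorem descProd_right {G : Type*} [Group G] (s : ℕ → G) (k t : ℕ) :
    descProd s k (t + 1) = descProd s (k + 1) t * s k := by
  induction t with
  | zero => simp [descProd]
  | succ t ih =>
    rw [descProd, ih, descProd, ← mul_assoc]
    congr 3
    omega

section inj
variable {G : Type*} [Group G] (s : ℕ → G) (n : ℕ)

theorem descProd_comm_low (hcomm : ∀ i j, i + 2 ≤ j → j < n → s i * s j = s j * s i)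
    (k t i : ℕ) (h : i + 2 ≤ k) (hk : k + t ≤ n) :
    descProd s k t * s i = s i * descProd s k t := by
  induction t with
  | zero => simp [descProd]
  | succ t ih =>
    rw [descProd, mul_assoc, ih (by omega), ← mul_assoc, ← mul_assoc,
      hcomm i (k + t) (by omega) (by omega)]

theorem descProd_comm_high (hcomm : ∀ i j, i + 2 ≤ j → j < n → s i * s j = s j * s i)
    (k t i : ℕ) (h : k + t + 1 ≤ i) (hk : i < n) :
    descProd s k t * s i = s i * descProd s k t := by
  induction t with
  | zero => simp [descProd]
  | succ t ih =>
    rw [descProd, mul_assoc, ih (by omega), ← mul_assoc, ← mul_assoc,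
      hcomm (k + t) i (by omega) (by omega)]

theorem descProd_shift (hcomm : ∀ i j, i + 2 ≤ j → j < n → s i * s j = s j * s i)
    (hbr : ∀ i, i + 1 < n → s i * s (i + 1) * s i = s (i + 1) * s i * s (i + 1))
    (k t i : ℕ) (h : k ≤ i) (hi : i + 1 < k + t) (hk : k + t ≤ n) :
    descProd s k t * s (i + 1) = s i * descProd s k t := by
  induction t with
  | zero => omega
  | succ t ih =>
    by_cases hlt : i + 1 < k + t
    · rw [descProd, mul_assoc, ih hlt (by omega), ← mul_assoc, ← mul_assoc,
        hcomm i (k + t) (by omega) (by omega)]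
    · obtain ⟨t', rfl⟩ : ∃ t', t = t' + 1 := ⟨t - 1, by omega⟩
      have hi' : i = k + t' := by omega
      subst hi'
      have h1 := descProd_comm_high s n hcomm k t' (k + t' + 1) (by omega) (by omega)
      have h2 := hbr (k + t') (by omega)
      rw [descProd, descProd, ← add_assoc, mul_assoc, mul_assoc, h1]
      simp only [← mul_assoc]
      rw [h2]

theorem closure_decomp (hsq : ∀ i, i < n → s i * s i = 1)
    (hcomm : ∀ i j, i + 2 ≤ j → j < n → s i * s j = s j * s i)
    (hbr : ∀ i, i + 1 < n → s i * s (i + 1) * s i = s (i + 1) * s i * s (i + 1))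
    (m : ℕ) (hm : m + 1 ≤ n) (g : G) (hg : g ∈ Submonoid.closure (s '' Set.Iio (m + 1))) :
    ∃ k t h, k + t = m + 1 ∧ h ∈ Submonoid.closure (s '' Set.Iio m) ∧ g = h * descProd s k t := by
  induction hg using Submonoid.closure_induction_right with
  | one => exact ⟨m + 1, 0, 1, rfl, one_mem _, by simp [descProd]⟩
  | mul_right y my x mi ih =>
    obtain ⟨i, hi, rfl⟩ := mi
    obtain ⟨k, t, h, hkt, hh, rfl⟩ := ih
    simp only [Set.mem_Iio] at hi
    rcases Nat.lt_trichotomy (i + 1) k with hlt | heq | hgt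
    · refine ⟨k, t, h * s i, hkt, mul_mem hh (Submonoid.subset_closure ⟨i, ?_, rfl⟩), ?_⟩
      · simp only [Set.mem_Iio]; omega
      · rw [mul_assoc, descProd_comm_low s n hcomm k t i (by omega) (by omega), mul_assoc]
    · subst heq
      exact ⟨i, t + 1, h, by omega, hh, by rw [mul_assoc, descProd_right]⟩
    · by_cases hik : i = k
      · subst hik
        obtain ⟨t', rfl⟩ : ∃ t', t = t' + 1 := ⟨t - 1, by omega⟩
        refine ⟨i + 1, t', h, by omega, hh, ?_⟩
        rw [descProd_right, mul_assoc, mul_assoc, hsq i (by omega), mul_one]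
      · obtain ⟨i', rfl⟩ : ∃ t', i = t' + 1 := ⟨i - 1, by omega⟩
        refine ⟨k, t, h * s i', hkt, mul_mem hh (Submonoid.subset_closure ⟨i', ?_, rfl⟩), ?_⟩
        · simp only [Set.mem_Iio]; omega
        · rw [mul_assoc, descProd_shift s n hcomm hbr k t i' (by omega) (by omega) (by omega),
            mul_assoc]

theorem map_descProd (φ : G →* Equiv.Perm ℕ)
    (hφ : ∀ i, i < n → φ (s i) = Equiv.swap i (i + 1)) (k t : ℕ) (hk : k + t ≤ n) :
    φ (descProd s k t) k = k + t := by
  induction t with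
  | zero => simp [descProd]
  | succ t ih =>
    rw [descProd, map_mul, Equiv.Perm.mul_apply, ih (by omega), hφ _ (by omega)]
    simp [add_assoc]

theorem map_closure_fix (φ : G →* Equiv.Perm ℕ)
    (hφ : ∀ i, i < n → φ (s i) = Equiv.swap i (i + 1)) (m : ℕ) (hm : m ≤ n) (g : G)
    (hg : g ∈ Submonoid.closure (s '' Set.Iio m)) (j : ℕ) (hj : m < j) : φ g j = j := by
  induction hg using Submonoid.closure_induction with
  | mem x hx =>
    obtain ⟨i, hi, rfl⟩ := hx
    simp only [Set.mem_Iio] at hi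
    rw [hφ i (by omega), Equiv.swap_apply_of_ne_of_ne] <;> omega
  | one => simp
  | mul x y _ _ hx hy => rw [map_mul, Equiv.Perm.mul_apply, hy, hx]

theorem eq_one_of_map_eq_one (hsq : ∀ i, i < n → s i * s i = 1)
    (hcomm : ∀ i j, i + 2 ≤ j → j < n → s i * s j = s j * s i)
    (hbr : ∀ i, i + 1 < n → s i * s (i + 1) * s i = s (i + 1) * s i * s (i + 1))
    (φ : G →* Equiv.Perm ℕ)
    (hφ : ∀ i, i < n → φ (s i) = Equiv.swap i (i + 1)) (m : ℕ) (hm : m ≤ n) (g : G)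
    (hg : g ∈ Submonoid.closure (s '' Set.Iio m)) (h1 : φ g = 1) : g = 1 := by
  induction m generalizing g with
  | zero =>
    have : s '' Set.Iio 0 = ∅ := by ext x; simp
    rw [this, Submonoid.closure_empty] at hg
    exact Submonoid.mem_bot.1 hg
  | succ m ih =>
    obtain ⟨k, t, h, hkt, hh, rfl⟩ := closure_decomp s n hsq hcomm hbr m hm g hg
    have h2 : φ (h * descProd s k t) k = k := by rw [h1]; rfl
    rw [map_mul, Equiv.Perm.mul_apply, map_descProd s n φ hφ k t (by omega),
      map_closure_fix s n φ hφ m (by omega) h hh _ (by omega)] at h2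
    have ht : t = 0 := by omega
    subst ht
    simp only [descProd, mul_one] at h1 ⊢
    exact ih (by omega) h hh h1

end inj

/-! ### The permutation representation and the length function -/

theorem An_apply (n : ℕ) (i j : Fin n) : (CoxeterMatrix.Aₙ n) i j =
    if i = j then 1 else (if (j : ℕ) + 1 = i ∨ (i : ℕ) + 1 = j then 3 else 2) := rfl

theorem swap_liftable (n : ℕ) : (CoxeterMatrix.Aₙ n).IsLiftable
    (fun i : Fin n => (Equiv.swap (i : ℕ) (i + 1) : Equiv.Perm ℕ)) := by
  intro i j
  rw [An_apply]
  beta_reduce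
  have key : ∀ a : ℕ, ((Equiv.swap a (a + 1) : Equiv.Perm ℕ) * Equiv.swap (a + 1) (a + 1 + 1)) ^ 3
      = 1 := by
    intro a
    ext x
    simp only [pow_succ, pow_zero, one_mul, Equiv.Perm.mul_apply, Equiv.swap_apply_def,
      Equiv.Perm.one_apply]
    grind
  have key' : ∀ a : ℕ, ((Equiv.swap (a + 1) (a + 1 + 1) : Equiv.Perm ℕ) * Equiv.swap a (a + 1)) ^ 3
      = 1 := by
    intro a
    ext x
    simp only [pow_succ, pow_zero, one_mul, Equiv.Perm.mul_apply, Equiv.swap_apply_def,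
      Equiv.Perm.one_apply]
    grind
  split_ifs with h1 h2
  · subst h1; simp
  · rcases h2 with h2 | h2
    · rw [← h2]; exact key' _
    · rw [← h2]; exact key _
  · have h3 : (i : ℕ) ≠ j := fun h => h1 (Fin.ext h)
    push Not at h2
    ext x
    simp only [pow_succ, pow_zero, one_mul, Equiv.Perm.mul_apply, Equiv.swap_apply_def,
      Equiv.Perm.one_apply]
    grind

section rep
variable {n : ℕ} {W : Type*} [Group W] (cs : CoxeterSystem (CoxeterMatrix.Aₙ n) W)

/-- The permutation representation. -/
noncomputable def rep : W →* Equiv.Perm ℕ := cs.lift ⟨_, swap_liftable n⟩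

theorem rep_simple (i : Fin n) : rep cs (cs.simple i) = Equiv.swap (i : ℕ) (i + 1) :=
  cs.lift_apply_simple (swap_liftable n) i

theorem eq_one_of_rep (w : W) (h : rep cs w = 1) : w = 1 := by
  let s : ℕ → W := fun i => if h : i < n then cs.simple ⟨i, h⟩ else 1
  have hs : ∀ i (h : i < n), s i = cs.simple ⟨i, h⟩ := fun i h => by simp [s, h]
  refine eq_one_of_map_eq_one s n ?_ ?_ ?_ (rep cs) ?_ n le_rfl w ?_ h
  · intro i hi; rw [hs i hi]; simp
  · intro i j hij hj
    rw [hs i (by omega), hs j hj]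
    have := cs.simple_mul_simple_pow ⟨i, by omega⟩ ⟨j, hj⟩
    rw [An_apply, if_neg (by simp; omega), if_neg (by simp; omega), pow_two] at this
    have h2 := eq_inv_of_mul_eq_one_left this
    simpa using h2
  · intro i hi
    rw [hs i (by omega), hs _ hi]
    have := cs.simple_mul_simple_pow ⟨i, by omega⟩ ⟨i + 1, hi⟩
    rw [An_apply, if_neg (by simp), if_pos (by simp)] at this
    have h3 : (cs.simple ⟨i, by omega⟩ * cs.simple ⟨i + 1, hi⟩ * cs.simple ⟨i, by omega⟩) *
      (cs.simple ⟨i + 1, hi⟩ * cs.simple ⟨i, by omega⟩ * cs.simple ⟨i + 1, hi⟩) = 1 := by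
      rw [← this]; simp only [pow_succ, pow_zero, one_mul, mul_assoc]
    have h2 := eq_inv_of_mul_eq_one_left h3
    simpa [mul_assoc] using h2
  · intro i hi; rw [hs i hi, rep_simple]
  · have : s '' Set.Iio n = Set.range cs.simple := by
      ext x; constructor
      · rintro ⟨i, hi, rfl⟩; exact ⟨⟨i, hi⟩, (hs i hi).symm⟩
      · rintro ⟨i, rfl⟩; exact ⟨i, i.2, hs i i.2⟩
    rw [this, cs.submonoid_closure_range_simple]; trivial

theorem rep_injective : Function.Injective (rep cs) :=
  (injective_iff_map_eq_one _).2 (eq_one_of_rep cs)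

theorem rep_fix (w : W) (j : ℕ) (hj : n < j) : rep cs w j = j := by
  induction w using cs.simple_induction_left with
  | one => simp
  | mul_simple_left w i ih =>
    rw [map_mul, Equiv.Perm.mul_apply, ih, rep_simple, Equiv.swap_apply_of_ne_of_ne] <;> omega

theorem rep_le (w : W) (j : ℕ) (hj : j ≤ n) : rep cs w j ≤ n := by
  by_contra h
  push Not at h
  have h1 := rep_fix cs w _ h
  have := (rep cs w).injective h1
  omega
end rep

/-- Inversion set. -/
def invSet (n : ℕ) (σ : Equiv.Perm ℕ) : Finset (ℕ × ℕ) :=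
  (Finset.range (n + 1) ×ˢ Finset.range (n + 1)).filter (fun p => p.1 < p.2 ∧ σ p.2 < σ p.1)

theorem mem_invSet (n : ℕ) (σ : Equiv.Perm ℕ) (a b : ℕ) :
    (a, b) ∈ invSet n σ ↔ a < b ∧ b ≤ n ∧ σ b < σ a := by
  simp [invSet]; grind

theorem invSet_swap (n i : ℕ) (hi : i < n) (σ : Equiv.Perm ℕ) (h : σ i < σ (i + 1)) :
    (invSet n (σ * Equiv.swap i (i + 1))).card = (invSet n σ).card + 1 := by
  let f : ℕ × ℕ ↪ ℕ × ℕ :=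
    ((Equiv.swap i (i + 1)).prodCongr (Equiv.swap i (i + 1))).toEmbedding
  have : invSet n (σ * Equiv.swap i (i + 1)) = insert (i, i + 1) ((invSet n σ).map f) := by
    ext ⟨a, b⟩
    have hm : (a, b) ∈ (invSet n σ).map f ↔
        (Equiv.swap i (i + 1) a, Equiv.swap i (i + 1) b) ∈ invSet n σ := by
      simp only [Finset.mem_map]
      constructor
      · rintro ⟨⟨x, y⟩, hx, hxy⟩
        simp only [f, Equiv.coe_toEmbedding, Equiv.prodCongr_apply, Prod.map, Prod.mk.injEq] at hxy
        rw [← hxy.1, ← hxy.2]; simpa using hx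
      · intro h; exact ⟨_, h, by simp [f]⟩
    rw [Finset.mem_insert, hm, mem_invSet, mem_invSet]
    simp only [Equiv.Perm.mul_apply, Prod.mk.injEq]
    simp only [Equiv.swap_apply_def]
    grind
  rw [this, Finset.card_insert_of_notMem, Finset.card_map]
  simp only [Finset.mem_map]
  rintro ⟨⟨x, y⟩, hx, hxy⟩
  rw [mem_invSet] at hx
  simp only [f, Equiv.coe_toEmbedding, Equiv.prodCongr_apply, Prod.map, Prod.mk.injEq] at hxy
  simp only [Equiv.swap_apply_def] at hxy
  grind

theorem invSet_swap_desc (n i : ℕ) (hi : i < n) (σ : Equiv.Perm ℕ) (h : σ (i + 1) < σ i) :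
    (invSet n (σ * Equiv.swap i (i + 1))).card + 1 = (invSet n σ).card := by
  have := invSet_swap n i hi (σ * Equiv.swap i (i + 1)) (by simpa using h)
  rw [← this, mul_assoc, Equiv.swap_mul_self, mul_one]

theorem perm_lt_or (σ : Equiv.Perm ℕ) (i : ℕ) : σ i < σ (i + 1) ∨ σ (i + 1) < σ i := by
  have : σ i ≠ σ (i + 1) := fun h => by simpa using σ.injective h
  omega

/-- A permutation without descents is the identity. -/
theorem eq_one_of_no_desc (n : ℕ) (σ : Equiv.Perm ℕ) (hfix : ∀ j, n < j → σ j = j)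
    (h : ∀ i, i < n → σ i < σ (i + 1)) : σ = 1 := by
  have hm : StrictMono σ := by
    apply strictMono_nat_of_lt_succ
    intro i
    rcases lt_or_ge i n with h1 | h1
    · exact h i h1
    · rw [hfix (i + 1) (by omega)]
      rcases h1.eq_or_lt with h2 | h2
      · subst h2
        by_contra hc
        have h3 : n + 1 < σ n := by
          have : σ n ≠ n + 1 := fun h => by
            have := σ.injective (h.trans (hfix (n + 1) (by omega)).symm)
            omega
          omega
        have := σ.injective (hfix _ (by omega : n < σ n))
        omega
      · rw [hfix i h2]; omega
  have hm' : StrictMono σ.symm := by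
    intro a b hab
    rw [← hm.lt_iff_lt]
    simpa using hab
  ext i
  apply le_antisymm _ hm.le_apply
  have := hm.monotone (hm'.le_apply (x := i))
  simpa using this

theorem perm_rev (n : ℕ) (p : ℕ → ℕ) (hle : p 0 ≤ n)
    (h : ∀ i, i < n → p (i + 1) < p i) (i : ℕ) (hi : i ≤ n) : p i = n - i := by
  have h1 : ∀ i, i ≤ n → p i + i ≤ n := by
    intro i
    induction i with
    | zero => intro _; simpa using hle
    | succ i ih => intro h2; have := ih (by omega); have := h i (by omega); omega
  have h2 : ∀ k, k ≤ n → k ≤ p (n - k) := by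
    intro k
    induction k with
    | zero => simp
    | succ k ih =>
      intro h2
      have h3 := ih (by omega)
      have h4 := h (n - (k + 1)) (by omega)
      rw [show n - (k + 1) + 1 = n - k by omega] at h4
      omega
  have h3 := h1 i hi
  have h4 := h2 (n - i) (by omega)
  rw [show n - (n - i) = i by omega] at h4
  omega

section len
variable {n : ℕ} {W : Type*} [Group W] (cs : CoxeterSystem (CoxeterMatrix.Aₙ n) W)

theorem inv_le_length (w : W) : (invSet n (rep cs w)).card ≤ cs.length w := by
  obtain ⟨ω, hω, rfl⟩ := cs.exists_isReduced w
  rw [hω.eq]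
  clear hω
  induction ω using List.reverseRecOn with
  | nil =>
    simp only [wordProd_nil, map_one, List.length_nil, nonpos_iff_eq_zero, Finset.card_eq_zero]
    ext ⟨a, b⟩
    rw [mem_invSet]
    simp
    omega
  | append_singleton l i ih =>
    rw [cs.wordProd_append, wordProd_singleton, map_mul, rep_simple, List.length_append,
      List.length_singleton]
    rcases perm_lt_or (rep cs (cs.wordProd l)) i with h | h
    · rw [invSet_swap n i i.2 _ h]; omega
    · have := invSet_swap_desc n i i.2 _ h; omega

theorem length_eq_inv (w : W) : cs.length w = (invSet n (rep cs w)).card := by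
  apply le_antisymm _ (inv_le_length cs w)
  induction hN : (invSet n (rep cs w)).card generalizing w with
  | zero =>
    have : w = 1 := by
      apply eq_one_of_rep cs
      apply eq_one_of_no_desc n _ (rep_fix cs w)
      intro i hi
      rcases perm_lt_or (rep cs w) i with h | h
      · exact h
      · have := invSet_swap_desc n i hi _ h; omega
    simp [this]
  | succ N ih =>
    obtain ⟨i, hi, hd⟩ : ∃ i, i < n ∧ rep cs w (i + 1) < rep cs w i := by
      by_contra hc
      push Not at hc
      have h1 : rep cs w = 1 := by
        apply eq_one_of_no_desc n _ (rep_fix cs w)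
        intro i hi
        rcases perm_lt_or (rep cs w) i with h | h
        · exact h
        · have := hc i hi; omega
      have h2 := inv_le_length cs w
      rw [eq_one_of_rep cs w h1, length_one] at h2
      rw [eq_one_of_rep cs w h1] at hN
      omega
    have h1 := invSet_swap_desc n i hi _ hd
    have h2 := ih (w * cs.simple ⟨i, hi⟩) (by rw [map_mul, rep_simple]; simp only; omega)
    have h3 := cs.length_mul_simple w ⟨i, hi⟩
    omega

theorem leftDesc_iff (g : W) (i : Fin n) : cs.length (cs.simple i * g) < cs.length g ↔
    rep cs g⁻¹ (i + 1) < rep cs g⁻¹ i := by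
  rw [← cs.length_inv, ← cs.length_inv g, mul_inv_rev, inv_simple, length_eq_inv, length_eq_inv,
    map_mul, rep_simple]
  rcases perm_lt_or (rep cs g⁻¹) i with h | h
  · have := invSet_swap n i i.2 _ h; omega
  · have := invSet_swap_desc n i i.2 _ h; omega

theorem longest_rep (w₀ : W) (hw₀ : ∀ v : W, cs.length v ≤ cs.length w₀) (i : ℕ) (hi : i ≤ n) :
    rep cs w₀⁻¹ i = n - i := by
  apply perm_rev n _ (rep_le cs _ 0 (by omega)) _ i hi
  intro i hi
  rw [← leftDesc_iff cs w₀ ⟨i, hi⟩]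
  exact lt_of_le_of_ne (hw₀ _) (cs.length_simple_mul_ne _ _)

theorem le_longest (w₀ : W) (hw₀ : ∀ v : W, cs.length v ≤ cs.length w₀) :
    n ≤ cs.length w₀ := by
  rw [← cs.length_inv, length_eq_inv]
  have : (Finset.range n).image (fun i => (i, i + 1)) ⊆ invSet n (rep cs w₀⁻¹) := by
    intro x hx
    simp only [Finset.mem_image, Finset.mem_range] at hx
    obtain ⟨i, hi, rfl⟩ := hx
    rw [mem_invSet, longest_rep cs w₀ hw₀ _ hi, longest_rep cs w₀ hw₀ i hi.le]
    omega
  have h2 := Finset.card_le_card this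
  rwa [Finset.card_image_of_injective _ (fun a b h => by simpa using h), Finset.card_range] at h2

end len

/-! ### Combinatorics of words in the natural numbers -/

/-- One commutation move, on words in the natural numbers. -/
def NStep (l₁ l₂ : List ℕ) : Prop :=
  ∃ (u v : List ℕ) (i j : ℕ), (i + 2 ≤ j ∨ j + 2 ≤ i) ∧
    l₁ = u ++ i :: j :: v ∧ l₂ = u ++ j :: i :: v

/-- Commutation equivalence, on words in the natural numbers. -/
def NEquiv : List ℕ → List ℕ → Prop := Relation.ReflTransGen NStep

theorem prefix_append_cases {p a b : List ℕ} (h : p <+: a ++ b) :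
    p <+: a ∨ ∃ t, p = a ++ t ∧ t <+: b := by
  obtain ⟨r, hr⟩ := h
  rw [List.append_eq_append_iff] at hr
  rcases hr with ⟨c, hc, _⟩ | ⟨c, hc, hd⟩
  · exact Or.inl ⟨c, hc.symm⟩
  · exact Or.inr ⟨c, hc, ⟨r, hd.symm⟩⟩

theorem NEquiv.append_left {l₁ l₂ : List ℕ} (h : NEquiv l₁ l₂) (a : List ℕ) :
    NEquiv (a ++ l₁) (a ++ l₂) := by
  refine Relation.ReflTransGen.lift (fun l => a ++ l) ?_ _ _ h
  rintro _ _ ⟨u, v, i, j, hij, rfl, rfl⟩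
  exact ⟨a ++ u, v, i, j, hij, by simp, by simp⟩

theorem NEquiv.append_right {l₁ l₂ : List ℕ} (h : NEquiv l₁ l₂) (a : List ℕ) :
    NEquiv (l₁ ++ a) (l₂ ++ a) := by
  refine Relation.ReflTransGen.lift (fun l => l ++ a) ?_ _ _ h
  rintro _ _ ⟨u, v, i, j, hij, rfl, rfl⟩
  exact ⟨u, v ++ a, i, j, hij, by simp, by simp⟩

theorem NEquiv.move (a : ℕ) (l : List ℕ) (h : ∀ x ∈ l, x + 2 ≤ a) :
    NEquiv (a :: l) (l ++ [a]) := by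
  induction l with
  | nil => exact Relation.ReflTransGen.refl
  | cons x l ih =>
    have h1 : NStep (a :: x :: l) (x :: a :: l) :=
      ⟨[], l, a, x, Or.inr (h x (by simp)), rfl, rfl⟩
    have h2 := (ih (fun y hy => h y (by simp [hy]))).append_left [x]
    exact Relation.ReflTransGen.head h1 h2

/-- The word attached to a subset `e`: product of the blocks `0 1 ⋯ k`, for `k ∈ e` decreasing. -/
def uWord (e : ℕ → Bool) : ℕ → List ℕ
  | 0 => []
  | k + 1 => (if e k then List.range (k + 1) else []) ++ uWord e k

/-- The sorting word of the longest element. -/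
def qWord (k : ℕ) : List ℕ := uWord (fun _ => true) k

theorem qWord_succ (k : ℕ) : qWord (k + 1) = List.range (k + 1) ++ qWord k := by
  simp [qWord, uWord]

theorem uWord_lt (e : ℕ → Bool) (k x : ℕ) (hx : x ∈ uWord e k) : x < k := by
  induction k with
  | zero => simp [uWord] at hx
  | succ k ih =>
    rw [uWord, List.mem_append] at hx
    rcases hx with hx | hx
    · split_ifs at hx
      · simpa using hx
      · simp at hx
    · have := ih hx; omega

theorem qWord_peel (k : ℕ) :
    NEquiv (qWord (k + 1)) (qWord k ++ (List.range (k + 1)).reverse) := by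
  induction k with
  | zero => exact Relation.ReflTransGen.refl
  | succ k ih =>
    have h1 := ih.append_left (List.range (k + 1 + 1))
    rw [← qWord_succ] at h1
    refine h1.trans ?_
    have h2 := NEquiv.move (k + 1) (qWord k) (fun x hx => by
      have := uWord_lt _ _ _ hx; omega)
    have h3 := (h2.append_left (List.range (k + 1))).append_right (List.range (k + 1)).reverse
    rw [List.range_succ (n := k + 1), qWord_succ k]
    simp only [List.reverse_append, List.reverse_cons, List.reverse_nil, List.nil_append,
      List.append_assoc, List.cons_append] at h3 ⊢
    exact h3

theorem qWord_starts (e : ℕ → Bool) (n : ℕ) : ∃ v, NEquiv (qWord n) (uWord e n ++ v) := by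
  induction n with
  | zero => exact ⟨[], Relation.ReflTransGen.refl⟩
  | succ n ih =>
    obtain ⟨v, hv⟩ := ih
    by_cases he : e n
    · refine ⟨v, ?_⟩
      rw [qWord_succ, uWord, if_pos he, List.append_assoc]
      exact hv.append_left _
    · refine ⟨v ++ (List.range (n + 1)).reverse, ?_⟩
      rw [uWord, if_neg he, List.nil_append, ← List.append_assoc]
      exact (qWord_peel n).trans (hv.append_right _)

theorem uWord_count (e : ℕ → Bool) (k i : ℕ) : (uWord e k).count i =
    (uWord e k).count (i + 1) + if i < k ∧ e i then 1 else 0 := by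
  induction k with
  | zero => simp [uWord]
  | succ k ih =>
    rw [uWord, List.count_append, List.count_append, ih]
    split_ifs <;> simp only [List.count_range, List.count_nil] <;> grind

/-- All prefixes have slowly decreasing letter counts. -/
def Valid (l : List ℕ) : Prop := ∀ p, p <+: l → ∀ i,
  p.count (i + 1) ≤ p.count i ∧ p.count i ≤ p.count (i + 1) + 1

theorem Valid.of_pre {l p : List ℕ} (h : Valid l) (hp : p <+: l) : Valid p :=
  fun q hq => h q (hq.trans hp)

theorem Valid.step {l₁ l₂ : List ℕ} (h : Valid l₁) (hs : NStep l₁ l₂) : Valid l₂ := by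
  obtain ⟨u, v, i, j, hij, rfl, rfl⟩ := hs
  intro p hp a
  rcases prefix_append_cases hp with hp | ⟨t, rfl, ht⟩
  · exact h p (hp.trans (List.prefix_append _ _)) a
  · rw [List.prefix_cons_iff] at ht
    rcases ht with rfl | ⟨t, rfl, ht⟩
    · exact h (u ++ []) (by simp) a
    · rw [List.prefix_cons_iff] at ht
      rcases ht with rfl | ⟨t, rfl, ht⟩
      · have h0 := h u (by simp) a
        have h1 := h (u ++ [i]) (by simp) a
        have h2 := h (u ++ [i, j]) (by simp) a
        simp only [List.count_append, List.count_cons, List.count_nil, beq_iff_eq] at h0 h1 h2 ⊢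
        grind
      · have h2 := h (u ++ i :: j :: t) (by simpa using ht) a
        simp only [List.count_append, List.count_cons, beq_iff_eq] at h2 ⊢
        grind

theorem qWord_valid (k : ℕ) : Valid (qWord k) := by
  induction k with
  | zero =>
    intro p hp i
    have : p = [] := by simpa [qWord, uWord] using hp
    simp [this]
  | succ k ih =>
    intro p hp i
    rw [qWord_succ] at hp
    rcases prefix_append_cases hp with hp | ⟨t, rfl, ht⟩
    · rw [List.prefix_iff_eq_take, List.take_range] at hp
      rw [hp]
      simp only [List.count_range]
      grind
    · have h1 := ih t ht i
      have h2 : ∀ x, k ≤ x → t.count x = 0 := by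
        intro x hx
        rw [List.count_eq_zero]
        intro hm
        have := uWord_lt _ _ _ (ht.subset hm)
        omega
      have h3 := h2 i
      have h4 := h2 (i + 1)
      simp only [List.count_append, List.count_range]
      grind

/-- The permutation of a word. -/
def wordPerm (l : List ℕ) : Equiv.Perm ℕ := (l.map (fun i => Equiv.swap i (i + 1))).prod

theorem wordPerm_apply (l : List ℕ) (h : Valid l) (j : ℕ) : wordPerm l j =
    l.count j + if j = 0 ∨ l.count (j - 1) = l.count j then j else 0 := by
  induction l using List.reverseRecOn generalizing j with
  | nil => simp [wordPerm]
  | append_singleton l i ih =>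
    have ih' := ih (h.of_pre (by simp))
    have hp : wordPerm (l ++ [i]) = wordPerm l * Equiv.swap i (i + 1) := by simp [wordPerm]
    rw [hp, Equiv.Perm.mul_apply, ih']
    have c1 := h l (by simp)
    have c2 := h (l ++ [i]) (by simp)
    simp only [List.count_append, List.count_singleton, beq_iff_eq] at c2 ⊢
    have a1 := c1 i
    have a2 := c2 i
    have a3 := c1 (i - 1)
    have a4 := c2 (i - 1)
    simp only [Equiv.swap_apply_def]
    rcases Nat.eq_zero_or_pos i with h0 | h0
    · subst h0
      by_cases hj : j = 0
      · subst hj; simp at *; grind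
      · by_cases hj1 : j = 1
        · subst hj1; simp at *; grind
        · have : ¬ (0 = j - 1) := by omega
          have : ¬ (0 = j) := by omega
          simp [*]
    · rw [show i - 1 + 1 = i by omega] at a3 a4
      by_cases hj : j = i
      · subst hj; grind
      · by_cases hj1 : j = i + 1
        · subst hj1; simp at *; grind
        · have : ¬ (i = j) := by omega
          by_cases hj0 : j = 0
          · subst hj0
            have : ¬ (0 = i) := by omega
            simp [*]
          · have : ¬ (i = j - 1) := by omega
            simp [*]

theorem count_eq_of_wordPerm (n : ℕ) (l l' : List ℕ) (h : Valid l) (h' : Valid l')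
    (hl : ∀ x ∈ l, x < n) (hl' : ∀ x ∈ l', x < n) (he : wordPerm l = wordPerm l') (i : ℕ) :
    l.count i = l'.count i := by
  have hz : ∀ x, n ≤ x → l.count x = 0 := fun x hx => by
    rw [List.count_eq_zero]; intro hm; have := hl x hm; omega
  have hz' : ∀ x, n ≤ x → l'.count x = 0 := fun x hx => by
    rw [List.count_eq_zero]; intro hm; have := hl' x hm; omega
  rcases Nat.le_total n i with hi | hi
  · rw [hz i hi, hz' i hi]
  · refine Nat.decreasingInduction' (P := fun i => l.count i = l'.count i) ?_ hi ?_
    · intro k _ _ ih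
      have e1 : wordPerm l (k + 1) = wordPerm l' (k + 1) := by rw [he]
      rw [wordPerm_apply l h, wordPerm_apply l' h'] at e1
      have b1 := h l (by simp) k
      have b2 := h' l' (by simp) k
      simp only [Nat.add_sub_cancel] at e1
      grind
    · rw [hz n le_rfl, hz' n le_rfl]

/-! ### The sorting word of the longest element -/

/-- Inverse permutation reached after `i` letters in the pass with parameter `K`. -/
def passState (K i v : ℕ) : ℕ :=
  if v < i then K - 1 - v else if v = i then K else if v ≤ K then K - v else v

theorem passState_last (K v : ℕ) (hK : 0 < K) : passState K K v = passState (K - 1) 0 v := by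
  simp only [passState]; grind

section sorting
variable {n : ℕ} {W : Type*} [Group W] (cs : CoxeterSystem (CoxeterMatrix.Aₙ n) W)

theorem finRange_drop (i : ℕ) (hi : i < n) :
    (List.finRange n).drop i = ⟨i, hi⟩ :: (List.finRange n).drop (i + 1) := by
  rw [List.drop_eq_getElem_cons (by simpa using hi)]
  simp

theorem sortAux_desc (K f : ℕ) (hK : K ≤ n) (d i : ℕ) (hd : i + d = K) (g : W)
    (hg : ∀ v, rep cs g⁻¹ v = passState K i v) :
    ∃ g', (∀ v, rep cs g'⁻¹ v = passState K K v) ∧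
      (sortAux cs (List.finRange n) (f + d) ((List.finRange n).drop i) g).map Fin.val =
      List.range' i d ++
        (sortAux cs (List.finRange n) f ((List.finRange n).drop K) g').map Fin.val := by
  induction d generalizing i g with
  | zero =>
    have : i = K := by omega
    subst this
    exact ⟨g, hg, by simp⟩
  | succ d ih =>
    have hi : i < n := by omega
    have hdesc : cs.length (cs.simple ⟨i, hi⟩ * g) < cs.length g := by
      rw [leftDesc_iff]
      simp only [hg, passState]
      grind
    obtain ⟨g', h1, h2⟩ := ih (i + 1) (by omega) (cs.simple ⟨i, hi⟩ * g) (by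
      intro v
      rw [mul_inv_rev, inv_simple, map_mul, rep_simple, Equiv.Perm.mul_apply, hg]
      simp only [passState, Equiv.swap_apply_def]
      grind)
    refine ⟨g', h1, ?_⟩
    rw [finRange_drop i hi, ← add_assoc, sortAux, if_pos hdesc, List.map_cons, h2,
      List.range'_succ]
    rfl

theorem sortAux_skip (K f : ℕ) (d i : ℕ) (hd : i + d = n) (hi : K ≤ i) (g : W)
    (hg : ∀ v, rep cs g⁻¹ v = passState K 0 v) :
    sortAux cs (List.finRange n) (f + 1 + d) ((List.finRange n).drop i) g =
      sortAux cs (List.finRange n) f (List.finRange n) g := by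
  induction d generalizing i with
  | zero =>
    have : i = n := by omega
    subst this
    have : (List.finRange i).drop i = [] := by simp
    rw [this, add_zero, sortAux]
  | succ d ih =>
    have hi' : i < n := by omega
    have hdesc : ¬ cs.length (cs.simple ⟨i, hi'⟩ * g) < cs.length g := by
      rw [leftDesc_iff]
      simp only [hg, passState]
      grind
    rw [finRange_drop i hi', ← add_assoc, sortAux, if_neg hdesc]
    exact ih (i + 1) (by omega) (by omega)

theorem sortAux_id (f : ℕ) (l : List (Fin n)) : sortAux cs (List.finRange n) f l 1 = [] := by
  induction f generalizing l with
  | zero => rfl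
  | succ f ih =>
    cases l with
    | nil => rw [sortAux, ih]
    | cons a l => rw [sortAux, if_neg (by simp), ih]

theorem sortAux_qWord (K f : ℕ) (hK : K ≤ n) (g : W)
    (hg : ∀ v, rep cs g⁻¹ v = passState K 0 v) :
    (sortAux cs (List.finRange n) (f + K * (n + 1)) (List.finRange n) g).map Fin.val
      = qWord K := by
  induction K generalizing g with
  | zero =>
    have : g = 1 := by
      rw [← inv_eq_one]
      apply eq_one_of_rep cs
      ext v
      rw [hg]; simp [passState]; grind
    rw [this, sortAux_id]; rfl
  | succ K ih =>
    obtain ⟨g', h1, h2⟩ := sortAux_desc cs (K + 1) (f + K * (n + 1) + 1 + (n - (K + 1)))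
      hK (K + 1) 0 (by omega) g hg
    have h3 : f + (K + 1) * (n + 1) = f + K * (n + 1) + 1 + (n - (K + 1)) + (K + 1) := by
      rw [Nat.add_mul]; omega
    have h4 : ∀ v, rep cs g'⁻¹ v = passState K 0 v := by
      intro v; rw [h1, passState_last _ _ (by omega)]; rfl
    rw [List.drop_zero] at h2
    rw [h3, h2, sortAux_skip cs K _ _ _ (by omega) (by omega) g' h4, ih (by omega) g' h4,
      qWord_succ, List.range_eq_range']

theorem sortingWord_longest (w₀ : W) (hw₀ : ∀ v : W, cs.length v ≤ cs.length w₀) :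
    (sortingWord cs (List.finRange n) w₀).map Fin.val = qWord n := by
  have h1 := le_longest cs w₀ hw₀
  rw [sortingWord, List.length_finRange]
  obtain ⟨c, hc⟩ := Nat.exists_eq_add_of_le h1
  have : (cs.length w₀ + 1) * (n + 1) = (c + 1) * (n + 1) + n * (n + 1) := by
    rw [hc]; ring
  rw [this]
  apply sortAux_qWord cs n _ le_rfl
  intro v
  rcases Nat.lt_or_ge n v with h | h
  · rw [rep_fix cs _ v h]; simp only [passState]; grind
  · rw [longest_rep cs w₀ hw₀ v h]; simp only [passState]; grind

end sorting

section general
variable {B : Type*} {M : CoxeterMatrix B} {W : Type*} [Group W] (cs : CoxeterSystem M W)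

theorem sortAux_length (cw : List B) (f : ℕ) (l : List B) (g : W) :
    cs.length ((cs.wordProd (sortAux cs cw f l g))⁻¹ * g) + (sortAux cs cw f l g).length
      = cs.length g := by
  induction f generalizing l g with
  | zero => simp [sortAux]
  | succ f ih =>
    cases l with
    | nil => rw [sortAux]; exact ih cw g
    | cons a l =>
      rw [sortAux]
      split_ifs with h
      · have h1 := ih l (cs.simple a * g)
        have h2 := cs.length_simple_mul g a
        rw [cs.wordProd_cons, mul_inv_rev, inv_simple, mul_assoc, List.length_cons]
        omega
      · exact ih l g

theorem sortAux_reduced (cw : List B) (f : ℕ) (l : List B) (g : W) :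
    cs.IsReduced (sortAux cs cw f l g) := by
  have h1 := sortAux_length cs cw f l g
  have h2 := cs.length_wordProd_le (sortAux cs cw f l g)
  have h3 := cs.length_mul_le (cs.wordProd (sortAux cs cw f l g))
    ((cs.wordProd (sortAux cs cw f l g))⁻¹ * g)
  rw [mul_inv_cancel_left] at h3
  unfold CoxeterSystem.IsReduced
  omega

theorem CommStep.reduced {l l' : List B} (h : CommStep M l l') (hl : cs.IsReduced l) :
    cs.IsReduced l' := by
  obtain ⟨u, v, i, j, hij, rfl, rfl⟩ := h
  have h1 := cs.simple_mul_simple_pow i j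
  rw [hij, pow_two] at h1
  have h2 : cs.simple i * cs.simple j = cs.simple j * cs.simple i := by
    have h2 := eq_inv_of_mul_eq_one_left h1
    simpa using h2
  have h3 : cs.wordProd (u ++ j :: i :: v) = cs.wordProd (u ++ i :: j :: v) := by
    simp only [cs.wordProd_append, cs.wordProd_cons]
    rw [← mul_assoc (cs.simple j), ← h2, mul_assoc]
  unfold CoxeterSystem.IsReduced at hl ⊢
  rw [h3, hl]
  simp

theorem CommEquiv.reduced {l l' : List B} (h : CommEquiv M l l') (hl : cs.IsReduced l) :
    cs.IsReduced l' := by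
  induction h with
  | refl => exact hl
  | tail _ h ih => exact CommStep.reduced cs h ih

end general

/-! ### Counting -/

theorem CommStep.map_val {n : ℕ} {l l' : List (Fin n)}
    (h : CommStep (CoxeterMatrix.Aₙ n) l l') : NStep (l.map Fin.val) (l'.map Fin.val) := by
  obtain ⟨u, v, i, j, hij, rfl, rfl⟩ := h
  refine ⟨u.map Fin.val, v.map Fin.val, i, j, ?_, by simp, by simp⟩
  rw [An_apply] at hij
  by_cases h1 : i = j
  · rw [if_pos h1] at hij; omega
  · rw [if_neg h1] at hij
    have : (i : ℕ) ≠ j := fun h => h1 (Fin.ext h)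
    split_ifs at hij with h2 <;> omega

theorem CommEquiv.valid {n : ℕ} {l l' : List (Fin n)}
    (h : CommEquiv (CoxeterMatrix.Aₙ n) l l') (hl : Valid (l.map Fin.val)) :
    Valid (l'.map Fin.val) := by
  induction h with
  | refl => exact hl
  | tail _ h ih => exact ih.step h.map_val

theorem NStep.lift {n : ℕ} {l : List (Fin n)} {b : List ℕ} (h : NStep (l.map Fin.val) b) :
    ∃ l', l'.map Fin.val = b ∧ CommStep (CoxeterMatrix.Aₙ n) l l' := by
  obtain ⟨u, v, i, j, hij, h1, rfl⟩ := h
  rw [List.map_eq_append_iff] at h1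
  obtain ⟨l₁, l₂, rfl, rfl, h2⟩ := h1
  rw [List.map_eq_cons_iff] at h2
  obtain ⟨a, l₃, rfl, rfl, h2⟩ := h2
  rw [List.map_eq_cons_iff] at h2
  obtain ⟨b, l₄, rfl, rfl, rfl⟩ := h2
  refine ⟨l₁ ++ b :: a :: l₄, by simp, l₁, l₄, a, b, ?_, rfl, rfl⟩
  rw [An_apply, if_neg, if_neg]
  · omega
  · intro h; rw [h] at hij; omega

theorem NEquiv.lift {n : ℕ} {l : List (Fin n)} {b : List ℕ} (h : NEquiv (l.map Fin.val) b) :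
    ∃ l', l'.map Fin.val = b ∧ CommEquiv (CoxeterMatrix.Aₙ n) l l' := by
  induction h with
  | refl => exact ⟨l, rfl, Relation.ReflTransGen.refl⟩
  | tail _ h ih =>
    obtain ⟨l₁, rfl, h1⟩ := ih
    obtain ⟨l₂, h2, h3⟩ := NStep.lift h
    exact ⟨l₂, h2, h1.tail h3⟩

section count
variable {n : ℕ} {W : Type*} [Group W] (cs : CoxeterSystem (CoxeterMatrix.Aₙ n) W)

theorem rep_wordProd (u : List (Fin n)) :
    rep cs (cs.wordProd u) = wordPerm (u.map Fin.val) := by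
  induction u with
  | nil => simp [wordPerm]
  | cons a u ih =>
    rw [cs.wordProd_cons, map_mul, ih, rep_simple]
    simp [wordPerm]

/-- Extend a subset of `Fin n` to the natural numbers. -/
def extBool (e : Fin n → Bool) (i : ℕ) : Bool := if h : i < n then e ⟨i, h⟩ else false

theorem exists_word (w₀ : W) (hw₀ : ∀ v : W, cs.length v ≤ cs.length w₀) (e : Fin n → Bool) :
    ∃ u : List (Fin n), u.map Fin.val = uWord (extBool e) n ∧ cs.IsReduced u ∧
      Valid (u.map Fin.val) ∧
      IsPrefixUpToComm (CoxeterMatrix.Aₙ n) u (sortingWord cs (List.finRange n) w₀) := by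
  obtain ⟨v, hv⟩ := qWord_starts (extBool e) n
  have hq := sortingWord_longest cs w₀ hw₀
  rw [← hq] at hv
  obtain ⟨l', h1, h2⟩ := NEquiv.lift hv
  have hval : Valid (l'.map Fin.val) := h2.valid (by rw [hq]; exact qWord_valid n)
  have hred : cs.IsReduced l' := CommEquiv.reduced cs h2 (sortAux_reduced cs _ _ _ _)
  rw [List.map_eq_append_iff] at h1
  obtain ⟨u, t, rfl, hu, _⟩ := h1
  refine ⟨u, hu, ?_, hval.of_pre (by simp), u ++ t, h2, by simp⟩
  have := hred.take u.length
  simpa using this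

theorem valid_of_starts (w₀ : W) (hw₀ : ∀ v : W, cs.length v ≤ cs.length w₀) (u : List (Fin n))
    (h : IsPrefixUpToComm (CoxeterMatrix.Aₙ n) u (sortingWord cs (List.finRange n) w₀)) :
    Valid (u.map Fin.val) := by
  obtain ⟨v, h1, h2⟩ := h
  have hval : Valid (v.map Fin.val) := h1.valid (by
    rw [sortingWord_longest cs w₀ hw₀]; exact qWord_valid n)
  exact hval.of_pre (h2.map _)

theorem val_lt (u : List (Fin n)) (x : ℕ) (hx : x ∈ u.map Fin.val) : x < n := by
  rw [List.mem_map] at hx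
  obtain ⟨a, _, rfl⟩ := hx
  exact a.2

theorem count_singletons (w₀ : W) (hw₀ : ∀ v : W, cs.length v ≤ cs.length w₀) :
    numSingletons cs (List.finRange n) w₀ = 2 ^ n := by
  choose U hU hred hval hpre using exists_word cs w₀ hw₀
  let f : (Fin n → Bool) → {w : W // IsCSingleton cs (List.finRange n) w₀ w} :=
    fun e => ⟨cs.wordProd (U e), U e, rfl, hred e, hpre e⟩
  have hcount : ∀ e i, ((U e).map Fin.val).count i =
      ((U e).map Fin.val).count (i + 1) + if i < n ∧ extBool e i then 1 else 0 := by
    intro e i; rw [hU e]; exact uWord_count _ _ _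
  have hinj : Function.Injective f := by
    intro e e' he
    have h1 : cs.wordProd (U e) = cs.wordProd (U e') := congrArg Subtype.val he
    have h2 : wordPerm ((U e).map Fin.val) = wordPerm ((U e').map Fin.val) := by
      rw [← rep_wordProd cs, ← rep_wordProd cs, h1]
    have h3 := count_eq_of_wordPerm n _ _ (hval e) (hval e') (val_lt _) (val_lt _) h2
    funext i
    have h4 := hcount e i
    have h5 := hcount e' i
    rw [← h3, ← h3] at h5
    simp only [extBool, i.2, dif_pos, true_and, Fin.eta] at h4 h5
    rw [h4] at h5
    have h6 := Nat.add_left_cancel h5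
    clear h4 h5 h3 h2 h1 he hcount
    cases h7 : e i <;> cases h8 : e' i <;> simp [h7, h8] at h6 ⊢
  have hsurj : Function.Surjective f := by
    rintro ⟨w, u, rfl, hr, hp⟩
    have hv := valid_of_starts cs w₀ hw₀ u hp
    let e : Fin n → Bool := fun i =>
      decide ((u.map Fin.val).count (i : ℕ) ≠ (u.map Fin.val).count ((i : ℕ) + 1))
    refine ⟨e, Subtype.ext ?_⟩
    show cs.wordProd (U e) = cs.wordProd u
    apply rep_injective cs
    rw [rep_wordProd, rep_wordProd]
    have hz : ∀ (l : List (Fin n)) x, n ≤ x → (l.map Fin.val).count x = 0 := fun l x hx => by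
      rw [List.count_eq_zero]; intro hm; have := val_lt l x hm; omega
    have hc : ∀ i, ((U e).map Fin.val).count i = (u.map Fin.val).count i := by
      intro i
      rcases Nat.le_total n i with hi | hi
      · rw [hz _ i hi, hz _ i hi]
      · refine Nat.decreasingInduction'
          (P := fun i => ((U e).map Fin.val).count i = (u.map Fin.val).count i) ?_ hi ?_
        · intro k hk _ ih
          have h1 := hcount e k
          have h2 := hv _ (List.prefix_refl _) k
          simp only [extBool, hk, dif_pos, true_and, e, decide_eq_true_eq] at h1
          rw [h1, ih]
          split_ifs with h3 <;> omega
        · rw [hz _ n le_rfl, hz _ n le_rfl]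
    ext j
    rw [wordPerm_apply _ (hval e), wordPerm_apply _ hv, hc, hc]
  rw [numSingletons, ← Nat.card_congr (Equiv.ofBijective f ⟨hinj, hsurj⟩)]
  simp

end count

/-- In type `A_n`, for the linear (Loday) Coxeter element `c_Lod = s₁s₂⋯s_n`, the number of
`c`-singletons is `2^n`. -/
theorem numSingletons_loday (n : ℕ) (hn : 1 ≤ n) {W : Type*} [Group W]
    (cs : CoxeterSystem (CoxeterMatrix.Aₙ n) W)
    (w₀ : W) (hw₀ : ∀ v : W, cs.length v ≤ cs.length w₀) :
    numSingletons cs (List.ofFn (fun i : Fin n => i)) w₀ = 2 ^ n := by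
  have h : List.ofFn (fun i : Fin n => i) = List.finRange n := List.ofFn_id n
  rw [h]
  exact count_singletons cs w₀ hw₀

end Cambrian
end
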